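/- arXiv:1401.2124 — 2 statements merged into one kernel-verified Lean document; each statement's English description precedes it below -/
import Mathlib

section
/- Let P = vc^k(Δ^n) be a truncation polytope with n ≥ 3 and k ≥ 0, with m = n + 1 + k facets. Then over a field k of characteristic zero: (a) β^{-i,2(i+1)}(P) = i·C(k+1, i+1); (b) β^{-i,2(i+n−1)}(P) = (k+1−i)·C(k+1, k+2−i); (c) β^{-i,2j}(P) = 0 for i+1 < j < i+n−1; (d) β^{0,0}(P) = β^{-(m−n),2m}(P) = 1; and all other bigraded Betti numbers are zero. -/
open Finset Module

/-- An abstract simplicial complex on the vertex type `V`: a collection of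
nonempty finite subsets of `V` (the *faces*), closed under passing to
nonempty subsets. -/
structure SimComplex (V : Type*) where
  faces : Set (Finset V)
  not_empty_mem : ∅ ∉ faces
  down_closed : ∀ ⦃s t : Finset V⦄, s ∈ faces → t ⊆ s → t.Nonempty → t ∈ faces

namespace SimComplex

variable {V : Type*}

/-- The `n`-dimensional faces of `K` (faces with `n + 1` vertices). -/
def Face (K : SimComplex V) (n : ℕ) : Type _ :=
  {s : Finset V // s ∈ K.faces ∧ s.card = n + 1}

/-- The space of simplicial `n`-chains of `K` with coefficients in `𝕜`. -/
abbrev chains (K : SimComplex V) (𝕜 : Type*) [Field 𝕜] (n : ℕ) : Type _ :=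
  K.Face n →₀ 𝕜

variable (𝕜 : Type*) [Field 𝕜] [LinearOrder V]

/-- The boundary of a single `(n+1)`-dimensional face, as an alternating sum of its
codimension-one subfaces (signs determined by the linear order on the vertices). -/
noncomputable def faceBoundary (K : SimComplex V) (n : ℕ) (s : K.Face (n + 1)) :
    K.chains 𝕜 n :=
  ∑ a ∈ s.1.attach, ((-1 : 𝕜) ^ (s.1.filter (fun b => b < a.1)).card) •
    Finsupp.single
      ⟨s.1.erase a.1,
        K.down_closed s.2.1 (Finset.erase_subset _ _)
          (Finset.card_pos.mp (by rw [Finset.card_erase_of_mem a.2, s.2.2]; omega)),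
        by rw [Finset.card_erase_of_mem a.2, s.2.2]; omega⟩ (1 : 𝕜)

/-- The simplicial boundary operator `∂ : C_{n+1}(K) → C_n(K)`. -/
noncomputable def boundary (K : SimComplex V) (n : ℕ) :
    K.chains 𝕜 (n + 1) →ₗ[𝕜] K.chains 𝕜 n :=
  Finsupp.lsum 𝕜 fun s => LinearMap.toSpanSingleton 𝕜 _ (K.faceBoundary 𝕜 n s)

/-- The augmentation `C_0(K) → 𝕜` sending every vertex to `1`. -/
noncomputable def augmentation (K : SimComplex V) : K.chains 𝕜 0 →ₗ[𝕜] 𝕜 :=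
  Finsupp.lsum 𝕜 fun _ => LinearMap.id

/-- The reduced cycles in degree `n`. -/
noncomputable def cycles (K : SimComplex V) : (n : ℕ) → Submodule 𝕜 (K.chains 𝕜 n)
  | 0 => LinearMap.ker (K.augmentation 𝕜)
  | (n + 1) => LinearMap.ker (K.boundary 𝕜 n)

/-- The dimension of the reduced simplicial homology `H̃_n(K; 𝕜)` in degree `n ≥ 0`
(over the field `𝕜`, this also equals the dimension of reduced cohomology). -/
noncomputable def hdimNat (K : SimComplex V) (n : ℕ) : ℕ :=
  finrank 𝕜 ↥(K.cycles 𝕜 n) -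
    finrank 𝕜 ↥(LinearMap.range (K.boundary 𝕜 n) ⊓ K.cycles 𝕜 n)

/-- The dimension of reduced simplicial (co)homology `H̃_i(K; 𝕜)` for `i : ℤ`;
in degree `-1` it is `1` precisely for the empty complex. -/
noncomputable def hdim (K : SimComplex V) (i : ℤ) : ℕ :=
  letI := Classical.dec (K.faces = ∅)
  if i = -1 then (if K.faces = ∅ then 1 else 0)
  else if 0 ≤ i then K.hdimNat 𝕜 i.toNat else 0

/-- The full subcomplex of `K` on a vertex subset `J`. -/
def restrict (K : SimComplex V) (J : Finset V) : SimComplex V where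
  faces := {s | s ∈ K.faces ∧ s ⊆ J}
  not_empty_mem := fun h => K.not_empty_mem h.1
  down_closed := fun _ _ hs hts ht => ⟨K.down_closed hs.1 hts ht, hts.trans hs.2⟩

/-- The bigraded Betti numbers `β^{-i,2j}(𝕜[K]) = dim 𝕜Tor^{-i,2j}_{𝕜[v₁,…,v_m]}(𝕜[K],𝕜)`
of the Stanley–Reisner ring of `K`, expressed through Hochster's formula:
`β^{-i,2j}(K) = ∑_{J ⊆ [m], |J| = j} dim H̃^{j-i-1}(K_J; 𝕜)`. -/
noncomputable def bbetti (K : SimComplex V) [Fintype V] (i j : ℕ) : ℕ :=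
  ∑ J ∈ Finset.powersetCard j (Finset.univ : Finset V),
    (K.restrict J).hdim 𝕜 ((j : ℤ) - i - 1)

/-- Bigraded Betti numbers with integer (possibly out-of-range) indices:
`Tor^{-i,2j}` vanishes unless `i, j ≥ 0`. -/
noncomputable def bbettiZ (K : SimComplex V) [Fintype V] (i j : ℤ) : ℕ :=
  if 0 ≤ i ∧ 0 ≤ j then K.bbetti 𝕜 i.toNat j.toNat else 0

/-- `F` is a facet (maximal face) of `K`. -/
def IsFacet (K : SimComplex V) (F : Finset V) : Prop :=
  F ∈ K.faces ∧ ∀ s ∈ K.faces, F ⊆ s → s = F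

end SimComplex
namespace SimComplex

/-- The boundary complex `∂Δ^{n 0} * ⋯ * ∂Δ^{n (r-1)}` of the simplicial polytope dual to
the product of simplices `Δ^{n 0} × ⋯ × Δ^{n (r-1)}`: a subset is a face iff it is nonempty
and misses at least one vertex from every join factor. -/
def prodSimplicesDual (r : ℕ) (n : Fin r → ℕ) :
    SimComplex (Σ p : Fin r, Fin (n p + 1)) where
  faces := {s | s.Nonempty ∧
    ∀ p : Fin r, ∃ q : Fin (n p + 1), (⟨p, q⟩ : Σ p : Fin r, Fin (n p + 1)) ∉ s}
  not_empty_mem := fun h => Finset.not_nonempty_empty h.1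
  down_closed := fun _ _ hs hts ht =>
    ⟨ht, fun p => (hs.2 p).imp fun _ hq hmem => hq (hts hmem)⟩

/-- The stellar subdivision of the simplicial complex `K` at the face `F`, with a new
apex vertex `none`: faces of `K` not containing `F` survive, and cones (with apex `none`)
over proper subsets of `F` are added.  When `F` is a facet of `K`, this is the complex
obtained by replacing the facet `F` with the cone over its boundary, i.e. the operation
dual to cutting a vertex of a simple polytope. -/
def stellar (K : SimComplex V) (F : Finset V) : SimComplex (Option V) where
  faces := {s | s.Nonempty ∧
    ((none ∉ s ∧ Finset.eraseNone s ∈ K.faces ∧ ¬ F ⊆ Finset.eraseNone s) ∨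
     (none ∈ s ∧ Finset.eraseNone s ⊂ F ∧
        (Finset.eraseNone s ∈ K.faces ∨ Finset.eraseNone s = ∅)))}
  not_empty_mem := fun h => Finset.not_nonempty_empty h.1
  down_closed := by
    rintro s t ⟨hsne, hs⟩ hts htne
    refine ⟨htne, ?_⟩
    have hsub : Finset.eraseNone t ⊆ Finset.eraseNone s := by
      intro a ha
      rw [Finset.mem_eraseNone] at ha ⊢
      exact hts ha
    rcases hs with ⟨hn, hf, hF⟩ | ⟨hn, hF, hf⟩
    · left
      have hnt : none ∉ t := fun h => hn (hts h)
      have htne' : (Finset.eraseNone t).Nonempty := by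
        obtain ⟨x, hx⟩ := htne
        match x with
        | none => exact absurd hx hnt
        | some a => exact ⟨a, Finset.mem_eraseNone.mpr hx⟩
      exact ⟨hnt, K.down_closed hf hsub htne',
        fun h => hF (h.trans hsub)⟩
    · have hKs : (Finset.eraseNone t).Nonempty → Finset.eraseNone t ∈ K.faces := by
        intro htne'
        have hsne' : (Finset.eraseNone s).Nonempty := htne'.mono hsub
        rcases hf with hf | hf
        · exact K.down_closed hf hsub htne'
        · rw [hf] at hsub
          exact absurd (Finset.subset_empty.mp hsub) htne'.ne_empty
      by_cases hnt : none ∈ t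
      · right
        refine ⟨hnt, lt_of_le_of_lt hsub hF, ?_⟩
        rcases Finset.eq_empty_or_nonempty (Finset.eraseNone t) with h | h
        · exact Or.inr h
        · exact Or.inl (hKs h)
      · left
        have htne' : (Finset.eraseNone t).Nonempty := by
          obtain ⟨x, hx⟩ := htne
          match x with
          | none => exact absurd hx hnt
          | some a => exact ⟨a, Finset.mem_eraseNone.mpr hx⟩
        refine ⟨hnt, hKs htne', fun h => ?_⟩
        exact (lt_of_le_of_lt (h.trans hsub) hF).ne rfl

/-- An isomorphism of simplicial complexes: a bijection of vertex types carrying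
faces exactly to faces. -/
def Iso {W : Type*} (K : SimComplex V) (L : SimComplex W) : Prop :=
  ∃ e : V ≃ W, ∀ s : Finset V, s ∈ K.faces ↔ s.map e.toEmbedding ∈ L.faces

end SimComplex

open SimComplex in
/-- `K` is (isomorphic to) the boundary complex `K_P` of a generalized truncation polytope
`P = vc^k(Δ^{n 0} × ⋯ × Δ^{n (r-1)})` of type `(k; n)`, i.e. it is obtained from
`∂Δ^{n 0} * ⋯ * ∂Δ^{n (r-1)}` by `k` successive stellar subdivisions of facets
(the operation dual to cutting a vertex of a simple polytope). -/
def IsGenTruncCx (r : ℕ) (n : Fin r → ℕ) : ℕ → (V : Type) → SimComplex V → Prop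
  | 0, _, K => Iso (prodSimplicesDual r n) K
  | (k + 1), _, K => ∃ (W : Type) (L : SimComplex W) (F : Finset W),
      IsGenTruncCx r n k W L ∧ L.IsFacet F ∧ Iso (stellar L F) K

set_option linter.unusedSectionVars false
set_option linter.unusedVariables false

namespace Stk

section alg
variable {V : Type} [Fintype V] [LinearOrder V] (𝕜 : Type) [Field 𝕜]

/-- incidence sign -/
def sg (a : V) (s : Finset V) : 𝕜 := (-1 : 𝕜) ^ (s.filter (fun b => b < a)).card

/-- boundary of a finset -/
noncomputable def bd (s : Finset V) : Finset V →₀ 𝕜 :=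
  ∑ a ∈ s, sg 𝕜 a s • Finsupp.single (s.erase a) (1 : 𝕜)

/-- linear extension -/
noncomputable def DD : (Finset V →₀ 𝕜) →ₗ[𝕜] (Finset V →₀ 𝕜) :=
  Finsupp.linearCombination 𝕜 (bd 𝕜)

lemma sg_ne (a : V) (s : Finset V) : sg 𝕜 a s ≠ 0 := by
  unfold sg; exact pow_ne_zero _ (by simp)

lemma sg_swap (a b : V) (s : Finset V) (ha : a ∈ s) (hb : b ∈ s) (hab : a < b) :
    sg 𝕜 a s * sg 𝕜 b (s.erase a) + sg 𝕜 b s * sg 𝕜 a (s.erase b) = 0 := by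
  have h1 : (s.erase b).filter (fun x => x < a) = s.filter (fun x => x < a) := by
    ext x; simp only [mem_filter, mem_erase]
    constructor
    · tauto
    · rintro ⟨h, h'⟩; exact ⟨⟨(h'.trans hab).ne, h⟩, h'⟩
  have h2 : (s.filter (fun x => x < b)) = insert a ((s.erase a).filter (fun x => x < b)) := by
    ext x; simp only [mem_filter, mem_insert, mem_erase]
    by_cases hx : x = a
    · subst hx; simp [ha, hab]
    · simp [hx]
  have h3 : a ∉ ((s.erase a).filter (fun x => x < b)) := by simp
  unfold sg
  rw [h1, h2, card_insert_of_notMem h3]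
  ring

lemma DD_bd (s : Finset V) : DD 𝕜 (bd 𝕜 s) = 0 := by
  unfold bd DD
  simp only [map_sum, map_smul, Finsupp.linearCombination_single, one_smul]
  simp only [bd, Finset.smul_sum, smul_smul]
  rw [Finset.sum_sigma']
  refine Finset.sum_involution (fun p _ => ⟨p.2, p.1⟩) ?_ ?_ ?_ ?_
  · rintro ⟨a, b⟩ hp
    simp only [mem_sigma, mem_erase] at hp
    obtain ⟨ha, hba, hb⟩ := hp
    dsimp only
    rw [Finset.erase_right_comm (a := b) (b := a), ← add_smul]
    have : sg 𝕜 a s * sg 𝕜 b (s.erase a) + sg 𝕜 b s * sg 𝕜 a (s.erase b) = 0 := by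
      rcases lt_or_gt_of_ne hba with h | h
      · rw [add_comm]; exact sg_swap 𝕜 b a s hb ha h
      · exact sg_swap 𝕜 a b s ha hb h
    rw [this, zero_smul]
  · rintro ⟨a, b⟩ hp _ h
    simp only [mem_sigma, mem_erase] at hp
    simp at h
    exact hp.2.1 h.1
  · rintro ⟨a, b⟩ hp
    simp only [mem_sigma, mem_erase] at hp ⊢
    exact ⟨hp.2.2, fun h => hp.2.1 h.symm, hp.1⟩
  · rintro ⟨a, b⟩ hp; rfl

/-- boundaries -/
noncomputable def bs (X : Finset (Finset V)) (e : ℕ) : Submodule 𝕜 (Finset V →₀ 𝕜) :=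
  Submodule.span 𝕜 (bd 𝕜 '' {s | s ∈ X ∧ s.card = e})

noncomputable def r (X : Finset (Finset V)) (e : ℕ) : ℕ := finrank 𝕜 (bs 𝕜 X e)

noncomputable def h (X : Finset (Finset V)) (e : ℕ) : ℤ :=
  ((X.filter (fun s => s.card = e)).card : ℤ) - r 𝕜 X e - r 𝕜 X (e + 1)

lemma bs_insert_ne (X : Finset (Finset V)) (σ : Finset V) (e : ℕ) (he : e ≠ σ.card) :
    bs 𝕜 (insert σ X) e = bs 𝕜 X e := by
  unfold bs
  congr 2
  ext s
  simp only [mem_insert, Set.mem_ofPred_eq]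
  constructor
  · rintro ⟨rfl | h, h'⟩
    · exact absurd h'.symm he
    · exact ⟨h, h'⟩
  · rintro ⟨h, h'⟩; exact ⟨Or.inr h, h'⟩

lemma bs_insert_eq (X : Finset (Finset V)) (σ : Finset V) :
    bs 𝕜 (insert σ X) σ.card = Submodule.span 𝕜 {bd 𝕜 σ} ⊔ bs 𝕜 X σ.card := by
  unfold bs
  rw [← Submodule.span_insert, ← Set.image_insert_eq]
  congr 2
  ext s
  simp only [mem_insert, Set.mem_ofPred_eq, Set.mem_insert_iff]
  constructor
  · rintro ⟨rfl | h, h'⟩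
    · exact Or.inl rfl
    · exact Or.inr ⟨h, h'⟩
  · rintro (rfl | ⟨h, h'⟩)
    · exact ⟨Or.inl rfl, rfl⟩
    · exact ⟨Or.inr h, h'⟩

lemma r_insert_mem (X : Finset (Finset V)) (σ : Finset V) (hm : bd 𝕜 σ ∈ bs 𝕜 X σ.card) :
    r 𝕜 (insert σ X) σ.card = r 𝕜 X σ.card := by
  unfold r
  rw [bs_insert_eq, sup_eq_right.mpr]
  simpa [Submodule.span_le] using hm

lemma r_insert_not (X : Finset (Finset V)) (σ : Finset V) (hm : bd 𝕜 σ ∉ bs 𝕜 X σ.card) :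
    r 𝕜 (insert σ X) σ.card = r 𝕜 X σ.card + 1 := by
  unfold r
  rw [bs_insert_eq]
  have hne : bd 𝕜 σ ≠ 0 := fun h => hm (h ▸ Submodule.zero_mem _)
  have h1 := Submodule.finrank_sup_add_finrank_inf_eq (Submodule.span 𝕜 {bd 𝕜 σ}) (bs 𝕜 X σ.card)
  have h2 : Submodule.span 𝕜 {bd 𝕜 σ} ⊓ bs 𝕜 X σ.card = ⊥ := by
    rw [← disjoint_iff]
    exact ((Submodule.disjoint_span_singleton' hne).mpr hm).symm
  rw [h2, finrank_bot, finrank_span_singleton hne] at h1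
  omega

lemma r_insert_ne (X : Finset (Finset V)) (σ : Finset V) (e : ℕ) (he : e ≠ σ.card) :
    r 𝕜 (insert σ X) e = r 𝕜 X e := by
  unfold r; rw [bs_insert_ne 𝕜 X σ e he]

lemma card_ins (X : Finset (Finset V)) (σ : Finset V) (hσ : σ ∉ X) (e : ℕ) :
    ((((insert σ X).filter (fun s => s.card = e)).card : ℕ) : ℤ) =
     (X.filter (fun s => s.card = e)).card + (if e = σ.card then 1 else 0) := by
  rw [filter_insert]
  split_ifs with h1 h2 h2
  · rw [card_insert_of_notMem (by simp [hσ])]; push_cast; ring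
  · exact absurd h1.symm h2
  · exact absurd h2.symm h1
  · simp

lemma h_insert_mem (X : Finset (Finset V)) (σ : Finset V) (hσ : σ ∉ X)
    (hm : bd 𝕜 σ ∈ bs 𝕜 X σ.card) (e : ℕ) :
    h 𝕜 (insert σ X) e = h 𝕜 X e + (if e = σ.card then 1 else 0) := by
  have hr : ∀ e, r 𝕜 (insert σ X) e = r 𝕜 X e := by
    intro e
    by_cases he : e = σ.card
    · subst he; exact r_insert_mem 𝕜 X σ hm
    · exact r_insert_ne 𝕜 X σ e he
  unfold h
  rw [hr, hr, card_ins X σ hσ]; ring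

lemma h_insert_not (X : Finset (Finset V)) (σ : Finset V) (hσ : σ ∉ X)
    (hm : bd 𝕜 σ ∉ bs 𝕜 X σ.card) (e : ℕ) :
    h 𝕜 (insert σ X) e = h 𝕜 X e - (if e + 1 = σ.card then 1 else 0) := by
  have hr : ∀ e, (r 𝕜 (insert σ X) e : ℤ) = r 𝕜 X e + (if e = σ.card then 1 else 0) := by
    intro e
    split_ifs with he
    · subst he; rw [r_insert_not 𝕜 X σ hm]; push_cast; ring
    · rw [r_insert_ne 𝕜 X σ e he]; simp
  unfold h
  rw [hr, hr, card_ins X σ hσ]; ring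

lemma bd_apply_of_not_subset (s σ : Finset V) (hs : ¬ σ ⊆ s) : bd 𝕜 s σ = 0 := by
  unfold bd
  rw [Finsupp.finsetSum_apply]
  refine Finset.sum_eq_zero fun a ha => ?_
  rw [Finsupp.smul_apply, Finsupp.single_eq_of_ne, smul_zero]
  rintro rfl
  exact hs (erase_subset _ _)

lemma bd_apply_insert (σ : Finset V) (g : V) (hg : g ∉ σ) :
    bd 𝕜 (insert g σ) σ = sg 𝕜 g (insert g σ) := by
  unfold bd
  rw [Finsupp.finsetSum_apply, Finset.sum_eq_single g]
  · simp [erase_insert hg]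
  · intro b hb hbg
    rw [Finsupp.smul_apply, Finsupp.single_eq_of_ne, smul_zero]
    intro h
    have : b ∈ σ := by
      rcases mem_insert.mp hb with h | h
      · exact absurd h hbg
      · exact h
    rw [h] at this
    simp at this
  · simp

lemma h_pair (X : Finset (Finset V)) (σ : Finset V) (g : V) (hg : g ∉ σ)
    (hX : ∀ s ∈ X, ¬ σ ⊆ s) (hf : ∀ v ∈ σ, (insert g σ).erase v ∈ X) (e : ℕ) :
    h 𝕜 (insert (insert g σ) (insert σ X)) e = h 𝕜 X e := by
  have hσ : σ ∉ X := fun h => hX _ h subset_rfl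
  have hτ : insert g σ ∉ insert σ X := by
    rw [mem_insert]
    rintro (h | h)
    · exact hg (h ▸ mem_insert_self g σ)
    · exact hX _ h (subset_insert _ _)
  have hc : (insert g σ).card = σ.card + 1 := card_insert_of_notMem hg
  rw [h_insert_not 𝕜 _ _ hτ, h_insert_mem 𝕜 _ _ hσ, hc]
  · simp
  · -- bd σ in span
    have h0 := DD_bd 𝕜 (insert g σ)
    rw [bd, sum_insert hg, map_add, map_sum] at h0
    simp only [map_smul, DD, Finsupp.linearCombination_single, one_smul, erase_insert hg] at h0
    have h1 : sg 𝕜 g (insert g σ) • bd 𝕜 σ ∈ bs 𝕜 X σ.card := by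
      rw [eq_neg_of_add_eq_zero_left h0]
      refine Submodule.neg_mem _ (Submodule.sum_mem _ fun v hv => Submodule.smul_mem _ _ ?_)
      refine Submodule.subset_span ⟨_, ⟨hf v hv, ?_⟩, rfl⟩
      rw [card_erase_of_mem (mem_insert_of_mem hv), hc]; simp
    exact (Submodule.smul_mem_iff _ (sg_ne 𝕜 _ _)).mp h1
  · intro hm
    have : bs 𝕜 (insert σ X) (insert g σ).card ≤ LinearMap.ker (Finsupp.lapply (R := 𝕜) (M := 𝕜) σ) := by
      unfold bs
      rw [Submodule.span_le]
      rintro _ ⟨s, ⟨hs, hs'⟩, rfl⟩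
      simp only [SetLike.mem_coe, LinearMap.mem_ker, Finsupp.lapply_apply]
      rcases mem_insert.mp hs with rfl | hs
      · omega
      · exact bd_apply_of_not_subset 𝕜 s σ (hX s hs)
    have h2 := this hm
    simp only [LinearMap.mem_ker, Finsupp.lapply_apply] at h2
    rw [bd_apply_insert 𝕜 σ g hg] at h2
    exact sg_ne 𝕜 _ _ h2

/-- down-closed -/
def Dn (X : Finset (Finset V)) : Prop := ∀ s ∈ X, ∀ t, t ⊆ s → t ∈ X

lemma toggle (g : V) : ∀ (N : ℕ) (X Y : Finset (Finset V)), (Y \ X).card = N → X ⊆ Y → Dn X → Dn Y →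
    (∀ s ∈ Y, s ∉ X → insert g s ∈ Y ∧ s.erase g ∉ X) → ∀ e, h 𝕜 Y e = h 𝕜 X e := by
  intro N
  induction N using Nat.strong_induction_on with
  | _ N ih =>
  intro X Y hN hXY hX hY ht e
  rcases (Y \ X).eq_empty_or_nonempty with h0 | h0
  · rw [subset_antisymm hXY (sdiff_eq_empty_iff_subset.mp h0)]
  obtain ⟨τ, hτ, hmax⟩ := exists_max_image (Y \ X) card h0
  rw [mem_sdiff] at hτ
  have hgτ : g ∈ τ := by
    by_contra hg
    have h1 := ht τ hτ.1 hτ.2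
    have h2 : insert g τ ∉ X := fun h => hτ.2 (hX _ h _ (subset_insert _ _))
    have := hmax (insert g τ) (mem_sdiff.mpr ⟨h1.1, h2⟩)
    rw [card_insert_of_notMem hg] at this
    omega
  obtain ⟨σ, hσ⟩ : ∃ σ, σ = τ.erase g := ⟨_, rfl⟩
  have hgσ : g ∉ σ := by rw [hσ]; simp
  have hτσ : τ = insert g σ := by rw [hσ, insert_erase hgτ]
  have hσX : σ ∉ X := hσ ▸ (ht τ hτ.1 hτ.2).2
  have hσY : σ ∈ Y := hY _ hτ.1 _ (hσ ▸ erase_subset _ _)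
  have hne : σ ≠ τ := fun h => hgσ (h ▸ hgτ)
  have hup : ∀ s ∈ Y, σ ⊆ s → s = σ ∨ s = τ := by
    intro s hs hsub
    have hsX : s ∉ X := fun h => hσX (hX _ h _ hsub)
    have h1 := (ht s hs hsX).1
    have h2 : insert g s ∉ X := fun h => hsX (hX _ h _ (subset_insert _ _))
    have h3 := hmax _ (mem_sdiff.mpr ⟨h1, h2⟩)
    have h4 : τ ⊆ insert g s := hτσ ▸ insert_subset_insert g hsub
    have h5 := eq_of_subset_of_card_le h4 h3
    by_cases hg : g ∈ s
    · right; rw [h5, insert_eq_of_mem hg]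
    · left; rw [hσ, h5, erase_insert hg]
  set Y' := (Y.erase τ).erase σ with hY'
  have hYY : Y = insert (insert g σ) (insert σ Y') := by
    rw [hY', insert_erase (mem_erase.mpr ⟨hne, hσY⟩), ← hτσ, insert_erase hτ.1]
  have hmem : ∀ s, s ∈ Y' ↔ s ≠ σ ∧ s ≠ τ ∧ s ∈ Y := by
    intro s; simp [hY']
  have hnot : ∀ s ∈ Y', ¬ σ ⊆ s := by
    intro s hs hsub
    obtain ⟨h1, h2, h3⟩ := (hmem s).mp hs
    rcases hup s h3 hsub with h | h
    · exact h1 h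
    · exact h2 h
  have hstep : h 𝕜 Y e = h 𝕜 Y' e := by
    rw [hYY]
    refine h_pair 𝕜 Y' σ g hgσ hnot ?_ e
    intro v hv
    rw [hmem]
    refine ⟨?_, ?_, ?_⟩
    · intro h; rw [← h] at hv; simp at hv
    · intro h; rw [← hτσ] at h
      have : v ∈ τ := hτσ ▸ mem_insert_of_mem hv
      rw [← h] at this; simp at this
    · exact hY _ hτ.1 _ (hτσ ▸ erase_subset _ _)
  rw [hstep]
  refine ih (Y' \ X).card ?_ X Y' rfl ?_ hX ?_ ?_ e
  · rw [← hN]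
    refine card_lt_card ⟨?_, ?_⟩
    · intro s hs
      rw [mem_sdiff] at hs ⊢
      exact ⟨((hmem s).mp hs.1).2.2, hs.2⟩
    · intro hs
      have := hs (mem_sdiff.mpr hτ)
      rw [mem_sdiff, hmem] at this
      exact this.1.2.1 rfl
  · intro s hs
    rw [hmem]
    exact ⟨fun h => hσX (h ▸ hs), fun h => hτ.2 (h ▸ hs), hXY hs⟩
  · intro s hs t hts
    have h1 := (hmem s).mp hs
    rw [hmem]
    refine ⟨?_, ?_, hY _ h1.2.2 _ hts⟩
    · rintro rfl; exact hnot s hs hts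
    · rintro rfl; exact hnot s hs ((hτσ ▸ subset_insert _ _ : σ ⊆ t).trans hts)
  · intro s hs hsX
    have h1 := (hmem s).mp hs
    have h2 := ht s h1.2.2 hsX
    refine ⟨?_, h2.2⟩
    rw [hmem]
    refine ⟨?_, ?_, h2.1⟩
    · intro h; exact hgσ (h ▸ mem_insert_self g s)
    · intro h
      by_cases hg : g ∈ s
      · exact h1.2.1 (by rw [← h, insert_eq_of_mem hg])
      · exact h1.1 (by rw [hσ, ← h, erase_insert hg])

lemma toggle' (g : V) (X Y : Finset (Finset V)) (hXY : X ⊆ Y) (hX : Dn X) (hY : Dn Y)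
    (ht : ∀ s ∈ Y, s ∉ X → insert g s ∈ Y ∧ s.erase g ∉ X) (e : ℕ) : h 𝕜 Y e = h 𝕜 X e :=
  toggle 𝕜 g _ X Y rfl hXY hX hY ht e

/-- dichotomy for adding a face `σ` -/
lemma h_dich (X : Finset (Finset V)) (σ : Finset V) (hσ : σ ∉ X) :
    (∀ e, h 𝕜 (insert σ X) e = h 𝕜 X e + (if e = σ.card then 1 else 0)) ∨
    (∀ e, h 𝕜 (insert σ X) e = h 𝕜 X e - (if e + 1 = σ.card then 1 else 0)) := by
  by_cases hm : bd 𝕜 σ ∈ bs 𝕜 X σ.card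
  · exact Or.inl (h_insert_mem 𝕜 X σ hσ hm)
  · exact Or.inr (h_insert_not 𝕜 X σ hσ hm)


/-- stellar subdivision of the top face `F` with apex `a` -/
def stel (L : Finset (Finset V)) (F : Finset V) (a : V) : Finset (Finset V) :=
  L.erase F ∪ F.ssubsets.image (insert a)

inductive St (n : ℕ) : ℕ → Finset V → Finset (Finset V) → Prop
  | base (S : Finset V) : S.card = n + 1 → St n 0 S S.ssubsets
  | step (k : ℕ) (S : Finset V) (L : Finset (Finset V)) (F : Finset V) (a : V) :
      St n k S L → F ∈ L → F.card = n → a ∉ S → St n (k + 1) (insert a S) (stel L F a)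

lemma mem_stel (L : Finset (Finset V)) (F : Finset V) (a : V) (haF : a ∉ F)
    (haL : ∀ s ∈ L, a ∉ s) (s : Finset V) :
    s ∈ stel L F a ↔ (a ∉ s ∧ s ∈ L ∧ s ≠ F) ∨ (a ∈ s ∧ s.erase a ⊂ F) := by
  unfold stel
  simp only [mem_union, mem_erase, mem_image, mem_ssubsets]
  constructor
  · rintro (⟨h1, h2⟩ | ⟨t, ht, rfl⟩)
    · exact Or.inl ⟨haL s h2, h2, h1⟩
    · right
      refine ⟨mem_insert_self _ _, ?_⟩
      rw [erase_insert (fun h => haF (ht.1 h))]; exact ht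
  · rintro (⟨h1, h2, h3⟩ | ⟨h1, h2⟩)
    · exact Or.inl ⟨h3, h2⟩
    · exact Or.inr ⟨_, h2, insert_erase h1⟩

structure Inv (n k : ℕ) (S : Finset V) (L : Finset (Finset V)) : Prop where
  cardS : S.card = n + 1 + k
  sub : ∀ s ∈ L, s ⊆ S
  cle : ∀ s ∈ L, s.card ≤ n
  pure : ∀ s ∈ L, ∃ F ∈ L, s ⊆ F ∧ F.card = n
  dn : Dn L
  vert : ∀ v ∈ S, {v} ∈ L

lemma Inv.empty {n k : ℕ} {S : Finset V} {L : Finset (Finset V)} (hI : Inv n k S L) : ∅ ∈ L := by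
  have : S.Nonempty := by rw [← card_pos, hI.cardS]; omega
  obtain ⟨v, hv⟩ := this
  exact hI.dn _ (hI.vert v hv) _ (empty_subset _)

lemma inv_base (n : ℕ) (hn : 3 ≤ n) (S : Finset V) (hS : S.card = n + 1) : Inv n 0 S S.ssubsets := by
  refine ⟨hS, ?_, ?_, ?_, ?_, ?_⟩
  · intro s hs; exact (mem_ssubsets.mp hs).1
  · intro s hs; have := card_lt_card (mem_ssubsets.mp hs); omega
  · intro s hs
    rw [mem_ssubsets] at hs
    obtain ⟨v, hv, hvs⟩ := exists_of_ssubset hs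
    refine ⟨S.erase v, mem_ssubsets.mpr (erase_ssubset hv), ?_, by rw [card_erase_of_mem hv]; omega⟩
    exact fun x hx => mem_erase.mpr ⟨fun h => hvs (h ▸ hx), hs.1 hx⟩
  · intro s hs t ht
    rw [mem_ssubsets] at hs ⊢
    exact lt_of_le_of_lt ht hs
  · intro v hv
    rw [mem_ssubsets, Finset.ssubset_iff_subset_ne]
    refine ⟨by simpa using hv, fun h => ?_⟩
    rw [← h] at hS; simp at hS; omega

lemma inv_step (n : ℕ) (hn : 3 ≤ n) (k : ℕ) (S : Finset V) (L : Finset (Finset V)) (F : Finset V) (a : V)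
    (hI : Inv n k S L) (hF : F ∈ L) (hFc : F.card = n) (ha : a ∉ S) :
    Inv n (k + 1) (insert a S) (stel L F a) := by
  have haL : ∀ s ∈ L, a ∉ s := fun s hs h => ha (hI.sub s hs h)
  have haF := haL F hF
  have hm := mem_stel L F a haF haL
  refine ⟨?_, ?_, ?_, ?_, ?_, ?_⟩
  · rw [card_insert_of_notMem ha, hI.cardS]; ring
  · intro s hs
    rcases (hm s).mp hs with ⟨h1, h2, h3⟩ | ⟨h1, h2⟩
    · exact (hI.sub s h2).trans (subset_insert _ _)
    · rw [← insert_erase h1]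
      exact insert_subset_insert _ (h2.1.trans (hI.sub F hF))
  · intro s hs
    rcases (hm s).mp hs with ⟨h1, h2, h3⟩ | ⟨h1, h2⟩
    · exact hI.cle s h2
    · have := card_lt_card h2
      rw [card_erase_of_mem h1] at this
      omega
  · have key : ∀ t, t ⊂ F → ∃ F' ∈ stel L F a, insert a t ⊆ F' ∧ F'.card = n := by
      intro t ht
      obtain ⟨v, hv, hvs⟩ := exists_of_ssubset ht
      have hav : a ∉ F.erase v := fun h => haF (mem_of_mem_erase h)
      refine ⟨insert a (F.erase v), ?_, ?_, ?_⟩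
      · rw [hm]; right
        refine ⟨mem_insert_self _ _, ?_⟩
        rw [erase_insert hav]
        exact erase_ssubset hv
      · apply insert_subset_insert
        exact fun x hx => mem_erase.mpr ⟨fun h => hvs (h ▸ hx), ht.1 hx⟩
      · rw [card_insert_of_notMem hav, card_erase_of_mem hv]; omega
    intro s hs
    rcases (hm s).mp hs with ⟨h1, h2, h3⟩ | ⟨h1, h2⟩
    · obtain ⟨F', hF', hsF, hc⟩ := hI.pure s h2
      by_cases hFF : F' = F
      · subst hFF
        obtain ⟨F'', g1, g2, g3⟩ := key s (Finset.ssubset_iff_subset_ne.mpr ⟨hsF, h3⟩)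
        exact ⟨F'', g1, (subset_insert _ _).trans g2, g3⟩
      · exact ⟨F', (hm _).mpr (Or.inl ⟨haL _ hF', hF', hFF⟩), hsF, hc⟩
    · have := key _ h2
      rwa [insert_erase h1] at this
  · intro s hs t ht
    rw [hm]
    rcases (hm s).mp hs with ⟨h1, h2, h3⟩ | ⟨h1, h2⟩
    · left
      refine ⟨fun h => h1 (ht h), hI.dn _ h2 _ ht, ?_⟩
      rintro rfl
      apply h3
      exact (eq_of_subset_of_card_le ht (by rw [hFc]; exact hI.cle s h2)).symm
    · by_cases hat : a ∈ t
      · right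
        exact ⟨hat, lt_of_le_of_lt (erase_subset_erase _ ht) h2⟩
      · left
        have : t ⊂ F := by
          refine lt_of_le_of_lt ?_ h2
          exact fun x hx => mem_erase.mpr ⟨fun h => hat (h ▸ hx), ht hx⟩
        exact ⟨hat, hI.dn _ hF _ this.1, this.ne⟩
  · intro v hv
    rw [hm]
    rcases mem_insert.mp hv with rfl | hv
    · right
      simp only [mem_singleton, true_and]
      rw [erase_singleton]
      exact empty_ssubset.mpr (card_pos.mp (by omega))
    · left
      refine ⟨?_, hI.vert v hv, ?_⟩
      · rw [mem_singleton]; rintro rfl; exact ha hv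
      · rintro rfl; simp at hFc; omega

lemma St.inv {n : ℕ} (hn : 3 ≤ n) {k : ℕ} {S : Finset V} {L : Finset (Finset V)} (hs : St n k S L) :
    Inv n k S L := by
  induction hs with
  | base S hS => exact inv_base n hn S hS
  | step k S L F a _ hF hFc ha ih => exact inv_step n hn k S L F a ih hF hFc ha

lemma Dn.filter {X : Finset (Finset V)} (hX : Dn X) (J : Finset V) : Dn (X.filter (· ⊆ J)) := by
  intro s hs t ht
  rw [mem_filter] at hs ⊢
  exact ⟨hX _ hs.1 _ ht, ht.trans hs.2⟩

/-- coning over a nonempty face `G` does not change homology -/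
lemma h_cone (X Y : Finset (Finset V)) (G : Finset V) (a : V) (hX : Dn X) (haX : ∀ s ∈ X, a ∉ s)
    (hG : G ∈ X) (hGn : G.Nonempty)
    (hY : ∀ s, s ∈ Y ↔ s ∈ X ∨ (a ∈ s ∧ s.erase a ⊆ G)) : Dn Y ∧ ∀ e, h 𝕜 Y e = h 𝕜 X e := by
  have hYd : Dn Y := by
    intro s hs t ht
    rw [hY] at hs ⊢
    rcases hs with hs | ⟨h1, h2⟩
    · exact Or.inl (hX _ hs _ ht)
    · by_cases hat : a ∈ t
      · exact Or.inr ⟨hat, (erase_subset_erase _ ht).trans h2⟩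
      · left
        refine hX _ hG _ (subset_trans ?_ h2)
        exact fun x hx => mem_erase.mpr ⟨fun h => hat (h ▸ hx), ht hx⟩
  refine ⟨hYd, fun e => ?_⟩
  obtain ⟨g, hg⟩ := hGn
  have hga : g ≠ a := fun h => haX _ hG (h ▸ hg)
  refine toggle' 𝕜 g X Y (fun s hs => (hY s).mpr (Or.inl hs)) hX hYd ?_ e
  intro s hs hsX
  rcases (hY s).mp hs with h1 | ⟨h1, h2⟩
  · exact absurd h1 hsX
  · refine ⟨(hY _).mpr (Or.inr ⟨mem_insert_of_mem h1, ?_⟩), ?_⟩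
    · rw [erase_insert_of_ne hga]
      exact insert_subset hg h2
    · intro h
      exact haX _ h (mem_erase.mpr ⟨hga.symm, h1⟩)

/-- stellar subdivision of `F` in `X` preserves homology -/
lemma h_stel (X Z : Finset (Finset V)) (F : Finset V) (a : V) (hX : Dn X) (haX : ∀ s ∈ X, a ∉ s)
    (hF : F ∈ X) (hFn : F.Nonempty) (hmax : ∀ s ∈ X, F ⊆ s → s = F)
    (hZ : ∀ s, s ∈ Z ↔ (s ∈ X ∧ s ≠ F) ∨ (a ∈ s ∧ s.erase a ⊂ F)) (e : ℕ) : h 𝕜 Z e = h 𝕜 X e := by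
  have haF := haX F hF
  let Y : Finset (Finset V) := univ.filter (fun s => s ∈ X ∨ (a ∈ s ∧ s.erase a ⊆ F))
  have hY : ∀ s, s ∈ Y ↔ s ∈ X ∨ (a ∈ s ∧ s.erase a ⊆ F) := by intro s; simp [Y]
  obtain ⟨hYd, hYh⟩ := h_cone 𝕜 X Y F a hX haX hF hFn hY
  rw [← hYh]
  symm
  have hZd : Dn Z := by
    intro s hs t ht
    rw [hZ] at hs ⊢
    rcases hs with ⟨h2, h3⟩ | ⟨h1, h2⟩
    · left
      refine ⟨hX _ h2 _ ht, ?_⟩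
      rintro rfl
      exact h3 (hmax s h2 ht)
    · by_cases hat : a ∈ t
      · right
        exact ⟨hat, lt_of_le_of_lt (erase_subset_erase _ ht) h2⟩
      · left
        have : t ⊂ F := by
          refine lt_of_le_of_lt ?_ h2
          exact fun x hx => mem_erase.mpr ⟨fun h => hat (h ▸ hx), ht hx⟩
        exact ⟨hX _ hF _ this.1, this.ne⟩
  refine toggle' 𝕜 a Z Y ?_ hZd hYd ?_ e
  · intro s hs
    rw [hY]
    rcases (hZ s).mp hs with h | h
    · exact Or.inl h.1
    · exact Or.inr ⟨h.1, h.2.1⟩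
  · intro s hs hsZ
    rw [hZ] at hsZ
    have : s.erase a = F := by
      rcases (hY s).mp hs with h1 | ⟨h1, h2⟩
      · have : s = F := by
          by_contra hne; exact hsZ (Or.inl ⟨h1, hne⟩)
        rw [this, erase_eq_of_notMem haF]
      · by_contra hne
        exact hsZ (Or.inr ⟨h1, Finset.ssubset_iff_subset_ne.mpr ⟨h2, hne⟩⟩)
    rw [this]
    refine ⟨?_, ?_⟩
    · rw [hY]; right
      refine ⟨mem_insert_self _ _, ?_⟩
      rw [← this]
      intro x hx; simp at hx ⊢; tauto
    · rw [hZ]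
      rintro (h | h)
      · exact h.2 rfl
      · exact haF h.1

lemma h_empty (e : ℕ) : h 𝕜 (∅ : Finset (Finset V)) e = 0 := by
  have hb : ∀ e, bs 𝕜 (∅ : Finset (Finset V)) e = ⊥ := by
    intro e
    unfold bs
    rw [Submodule.span_eq_bot]
    rintro _ ⟨s, ⟨h1, h2⟩, rfl⟩
    simp at h1
  unfold h r
  rw [hb, hb, finrank_bot]
  simp

lemma Dn_empty : Dn (∅ : Finset (Finset V)) := by
  intro s hs; simp at hs

/-- top homology facts -/
structure Top (n : ℕ) (L : Finset (Finset V)) : Prop where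
  whole : ∀ e, h 𝕜 L e = if e = n then 1 else 0
  er : ∀ F ∈ L, F.card = n → h 𝕜 (L.erase F) n = 0

lemma Dn_powerset (S : Finset V) : Dn S.powerset := by
  intro s hs t ht
  rw [mem_powerset] at hs ⊢
  exact ht.trans hs

lemma h_powerset (S : Finset V) (hS : S.Nonempty) (e : ℕ) : h 𝕜 S.powerset e = 0 := by
  obtain ⟨g, hg⟩ := hS
  rw [← h_empty 𝕜 (V := V) e]
  refine toggle' 𝕜 g ∅ _ (empty_subset _) Dn_empty (Dn_powerset S) ?_ e
  intro s hs _
  rw [mem_powerset] at *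
  exact ⟨insert_subset hg hs, by simp⟩

lemma top_base (n : ℕ) (hn : 3 ≤ n) (S : Finset V) (hS : S.card = n + 1) : Top 𝕜 n S.ssubsets := by
  have hSn : S.Nonempty := by rw [← card_pos]; omega
  have hI := inv_base n hn S hS
  constructor
  · intro e
    have h0 := h_powerset 𝕜 S hSn
    have hins : S.powerset = insert S S.ssubsets := by
      rw [ssubsets, insert_erase (mem_powerset_self S)]
    have hnot : S ∉ S.ssubsets := by simp
    rw [hins] at h0
    have hbd : bd 𝕜 S ∉ bs 𝕜 S.ssubsets S.card := by
      have : bs 𝕜 S.ssubsets S.card = ⊥ := by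
        unfold bs
        rw [Submodule.span_eq_bot]
        rintro _ ⟨s, ⟨h1, h2⟩, rfl⟩
        have := hI.cle s h1
        omega
      rw [this, Submodule.mem_bot]
      intro hz
      obtain ⟨g, hg⟩ := hSn
      have := bd_apply_insert 𝕜 (S.erase g) g (by simp)
      rw [insert_erase hg, hz] at this
      exact sg_ne 𝕜 _ _ this.symm
    have := h_insert_not 𝕜 S.ssubsets S hnot hbd e
    rw [h0, hS] at this
    simp only [add_left_inj] at this
    linarith
  · intro F hF hFc
    rw [mem_ssubsets] at hF
    obtain ⟨v, hv, hvs⟩ := exists_of_ssubset hF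
    have hFe : F = S.erase v := by
      refine eq_of_subset_of_card_le ?_ ?_
      · exact fun x hx => mem_erase.mpr ⟨fun h => hvs (h ▸ hx), hF.1 hx⟩
      · rw [card_erase_of_mem hv]; omega
    rw [← h_empty 𝕜 (V := V) n]
    refine toggle' 𝕜 v ∅ _ (empty_subset _) Dn_empty ?_ ?_ n
    · intro s hs t ht
      rw [mem_erase] at hs ⊢
      refine ⟨?_, hI.dn _ hs.2 _ ht⟩
      rintro rfl
      exact hs.1 (eq_of_subset_of_card_le ht (by rw [hFc]; exact hI.cle s hs.2)).symm
    · intro s hs _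
      rw [mem_erase, mem_ssubsets] at *
      refine ⟨⟨?_, ?_⟩, by simp⟩
      · rintro rfl; exact hvs (mem_insert_self _ _)
      · rw [Finset.ssubset_iff_subset_ne] at *
        refine ⟨insert_subset hv hs.2.1, fun h => ?_⟩
        by_cases hvm : v ∈ s
        · rw [insert_eq_of_mem hvm] at h; exact hs.2.2 h
        · apply hs.1; rw [hFe, ← h, erase_insert hvm]

lemma top_step (n : ℕ) (hn : 3 ≤ n) (k : ℕ) (S : Finset V) (L : Finset (Finset V)) (F : Finset V) (a : V)
    (hI : Inv n k S L) (hT : Top 𝕜 n L) (hF : F ∈ L) (hFc : F.card = n) (ha : a ∉ S) :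
    Top 𝕜 n (stel L F a) := by
  have haL : ∀ s ∈ L, a ∉ s := fun s hs h => ha (hI.sub s hs h)
  have haF := haL F hF
  have hm := mem_stel L F a haF haL
  have hFn : F.Nonempty := by rw [← card_pos]; omega
  have hmax : ∀ s ∈ L, F ⊆ s → s = F := fun s hs hFs =>
    (eq_of_subset_of_card_le hFs (by rw [hFc]; exact hI.cle s hs)).symm
  have hIK := inv_step n hn k S L F a hI hF hFc ha
  have dner : ∀ F' ∈ L, F'.card = n → Dn (L.erase F') := by
    intro F' hF' hF'c s hs t ht
    rw [mem_erase] at hs ⊢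
    refine ⟨?_, hI.dn _ hs.2 _ ht⟩
    rintro rfl
    exact hs.1 (eq_of_subset_of_card_le ht (by rw [hF'c]; exact hI.cle s hs.2)).symm
  constructor
  · intro e
    rw [← hT.whole]
    refine h_stel 𝕜 L _ F a hI.dn haL hF hFn hmax ?_ e
    intro s; rw [hm]
    constructor
    · rintro (h | h)
      · exact Or.inl h.2
      · exact Or.inr h
    · rintro (h | h)
      · exact Or.inl ⟨haL _ h.1, h⟩
      · exact Or.inr h
  · intro F' hF' hF'c
    rcases (hm F').mp hF' with ⟨h1, h2, h3⟩ | ⟨h1, h2⟩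
    · rw [← hT.er F' h2 hF'c]
      refine h_stel 𝕜 (L.erase F') _ F a (dner F' h2 hF'c) (fun s hs => haL s (mem_of_mem_erase hs))
        (mem_erase.mpr ⟨h3.symm, hF⟩) hFn (fun s hs => hmax s (mem_of_mem_erase hs)) ?_ n
      intro s
      rw [mem_erase, hm, mem_erase]
      constructor
      · rintro ⟨h, h' | h'⟩
        · exact Or.inl ⟨⟨h, h'.2.1⟩, h'.2.2⟩
        · exact Or.inr h'
      · rintro (h | h)
        · exact ⟨h.1.1, Or.inl ⟨haL _ h.1.2, h.1.2, h.2⟩⟩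
        · exact ⟨fun h' => h1 (h' ▸ h.1), Or.inr h⟩
    · obtain ⟨v, hv, hvs⟩ := exists_of_ssubset h2
      have hva : v ≠ a := fun h => haF (h ▸ hv)
      have hFe : F'.erase a = F.erase v := by
        refine eq_of_subset_of_card_le ?_ ?_
        · exact fun x hx => mem_erase.mpr ⟨fun h => hvs (h ▸ hx), h2.1 hx⟩
        · rw [card_erase_of_mem hv, card_erase_of_mem h1]; omega
      rw [← hT.er F hF hFc]
      refine toggle' 𝕜 v (L.erase F) _ ?_ (dner F hF hFc) ?_ ?_ n
      · intro s hs
        rw [mem_erase] at hs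
        rw [mem_erase, hm]
        exact ⟨fun h => haL s hs.2 (h ▸ h1), Or.inl ⟨haL s hs.2, hs.2, hs.1⟩⟩
      · intro s hs t ht
        rw [mem_erase] at hs ⊢
        refine ⟨?_, hIK.dn _ hs.2 _ ht⟩
        rintro rfl
        exact hs.1 (eq_of_subset_of_card_le ht (by rw [hF'c]; exact hIK.cle s hs.2)).symm
      · intro s hs hsX
        rw [mem_erase, hm] at hs
        rw [mem_erase] at hsX
        rcases hs with ⟨hsF, hs | hs⟩
        · exact absurd ⟨hs.2.2, hs.2.1⟩ hsX
        · have hvF : v ∉ F' := fun h => hvs (mem_erase.mpr ⟨hva, h⟩)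
          refine ⟨?_, ?_⟩
          · rw [mem_erase, hm]
            refine ⟨fun h => hvF (h ▸ mem_insert_self _ _), Or.inr ⟨mem_insert_of_mem hs.1, ?_⟩⟩
            rw [erase_insert_of_ne hva, Finset.ssubset_iff_subset_ne]
            refine ⟨insert_subset hv hs.2.1, fun h => ?_⟩
            by_cases hvm : v ∈ s.erase a
            · rw [insert_eq_of_mem hvm] at h; exact hs.2.ne h
            · apply hsF
              rw [← insert_erase hs.1, ← insert_erase h1, hFe, ← h, erase_insert hvm]
          · intro h
            exact haL _ (mem_of_mem_erase h) (mem_erase.mpr ⟨hva.symm, hs.1⟩)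

lemma St.top {n : ℕ} (hn : 3 ≤ n) {k : ℕ} {S : Finset V} {L : Finset (Finset V)} (hs : St n k S L) :
    Top 𝕜 n L := by
  induction hs with
  | base S hS => exact top_base 𝕜 n hn S hS
  | step k S L F a hL hF hFc ha ih => exact top_step 𝕜 n hn k S L F a (hL.inv hn) ih hF hFc ha

lemma h_mono (n : ℕ) (X Z : Finset (Finset V)) (hZ : ∀ s ∈ Z, s.card ≤ n) :
    h 𝕜 X n ≤ h 𝕜 (Z ∪ X) n := by
  induction Z using Finset.induction_on with
  | empty => simp
  | insert σ Z _ ih =>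
    have ih' := ih (fun s hs => hZ s (mem_insert_of_mem hs))
    have hc := hZ σ (mem_insert_self _ _)
    rw [insert_union]
    by_cases hm : σ ∈ Z ∪ X
    · rwa [insert_eq_of_mem hm]
    · rcases h_dich 𝕜 (Z ∪ X) σ hm with h1 | h1
      · rw [h1]; split_ifs <;> omega
      · rw [h1, if_neg (by omega)]; omega

lemma h_mono' (n : ℕ) (X Y : Finset (Finset V)) (hXY : X ⊆ Y) (hY : ∀ s ∈ Y, s.card ≤ n) :
    h 𝕜 X n ≤ h 𝕜 Y n := by
  have := h_mono 𝕜 n X Y hY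
  rwa [union_eq_left.mpr hXY] at this

lemma h_nonneg (n : ℕ) (X : Finset (Finset V)) (hX : ∀ s ∈ X, s.card ≤ n) : 0 ≤ h 𝕜 X n := by
  rw [← h_empty 𝕜 (V := V) n]
  exact h_mono' 𝕜 n ∅ X (empty_subset _) hX

lemma h_top_J {n k : ℕ} {S : Finset V} {L : Finset (Finset V)} (hI : Inv n k S L) (hT : Top 𝕜 n L)
    (J : Finset V) (hJ : J ⊆ S) (hJS : J ≠ S) : h 𝕜 (L.filter (· ⊆ J)) n = 0 := by
  obtain ⟨v, hv, hvJ⟩ := exists_of_ssubset (Finset.ssubset_iff_subset_ne.mpr ⟨hJ, hJS⟩)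
  obtain ⟨F, hF, hvF, hFc⟩ := hI.pure _ (hI.vert v hv)
  rw [singleton_subset_iff] at hvF
  apply le_antisymm
  · rw [← hT.er F hF hFc]
    refine h_mono' 𝕜 n _ _ ?_ (fun s hs => hI.cle s (mem_of_mem_erase hs))
    intro s hs
    rw [mem_filter] at hs
    refine mem_erase.mpr ⟨?_, hs.1⟩
    rintro rfl
    exact hvJ (hs.2 hvF)
  · exact h_nonneg 𝕜 n _ (fun s hs => hI.cle s (mem_of_mem_filter _ hs))

lemma h_sing_empty (e : ℕ) : h 𝕜 ({∅} : Finset (Finset V)) e = if e = 0 then 1 else 0 := by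
  have := h_insert_mem 𝕜 (∅ : Finset (Finset V)) ∅ (by simp) (by simp [bd]) e
  rw [h_empty, card_empty, zero_add, insert_empty_eq] at this
  exact this

lemma filter_empty {n k : ℕ} {S : Finset V} {L : Finset (Finset V)} (hI : Inv n k S L) :
    L.filter (· ⊆ ∅) = {∅} := by
  ext s
  simp only [mem_filter, subset_empty, mem_singleton]
  constructor
  · exact fun h => h.2
  · rintro rfl; exact ⟨hI.empty, rfl⟩

section step
variable {n k : ℕ} {S : Finset V} {L : Finset (Finset V)} {F : Finset V} {a : V}

lemma hJ_out (hn : 3 ≤ n) (hI : Inv n k S L) (hT : Top 𝕜 n L) (hF : F ∈ L) (hFc : F.card = n) (ha : a ∉ S)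
    (J : Finset V) (hJ : J ⊆ S) (e : ℕ) :
    h 𝕜 ((stel L F a).filter (· ⊆ J)) e = h 𝕜 (L.filter (· ⊆ J)) e
      + (if e + 1 = n ∧ F ⊆ J ∧ J ≠ S then 1 else 0) - (if e = n ∧ J = S then 1 else 0) := by
  have haL : ∀ s ∈ L, a ∉ s := fun s hs h => ha (hI.sub s hs h)
  have haF := haL F hF
  have hm := mem_stel L F a haF haL
  have haJ : a ∉ J := fun h => ha (hJ h)
  have hKJ : (stel L F a).filter (· ⊆ J) = (L.filter (· ⊆ J)).erase F := by
    ext s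
    rw [mem_erase, mem_filter, mem_filter, hm]
    constructor
    · rintro ⟨h1 | h1, h2⟩
      · exact ⟨h1.2.2, h1.2.1, h2⟩
      · exact absurd (h2 h1.1) haJ
    · rintro ⟨h1, h2, h3⟩
      exact ⟨Or.inl ⟨haL s h2, h2, h1⟩, h3⟩
  rw [hKJ]
  by_cases hFJ : F ⊆ J
  · have hFm : F ∈ L.filter (· ⊆ J) := mem_filter.mpr ⟨hF, hFJ⟩
    have hd := h_dich 𝕜 ((L.filter (· ⊆ J)).erase F) F (by simp)
    rw [insert_erase hFm, hFc] at hd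
    by_cases hJS : J = S
    · subst hJS
      have hLJ : L.filter (· ⊆ J) = L := filter_true_of_mem (fun s hs => hI.sub s hs)
      rw [hLJ] at hd ⊢
      have h1 := hT.whole n
      have h2 := hT.er F hF hFc
      rcases hd with hd | hd
      · rw [hd]; simp
      · have := hd n
        rw [h1, h2] at this
        simp at this
    · have h1 := h_top_J 𝕜 hI hT J hJ hJS
      rcases hd with hd | hd
      · have h3 := hd n
        have h4 := h_nonneg 𝕜 n ((L.filter (· ⊆ J)).erase F)
          (fun s hs => hI.cle s (mem_of_mem_filter _ (mem_of_mem_erase hs)))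
        rw [h1, if_pos rfl] at h3
        omega
      · rw [hd]; simp [hFJ, hJS]
  · have hJS : J ≠ S := by rintro rfl; exact hFJ (hI.sub F hF)
    rw [erase_eq_of_notMem (by simp [hFJ])]
    simp [hFJ, hJS]

lemma hJ_in (hn : 3 ≤ n) (hI : Inv n k S L) (hF : F ∈ L) (hFc : F.card = n) (ha : a ∉ S)
    (J : Finset V) (hJ : J ⊆ S) (e : ℕ) :
    h 𝕜 ((stel L F a).filter (· ⊆ insert a J)) e = h 𝕜 (L.filter (· ⊆ J)) e
      + (if e = 1 ∧ J ⊆ S \ F ∧ J ≠ ∅ then 1 else 0) - (if e = 0 ∧ J = ∅ then 1 else 0) := by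
  have haL : ∀ s ∈ L, a ∉ s := fun s hs h => ha (hI.sub s hs h)
  have haF := haL F hF
  have hm := mem_stel L F a haF haL
  have haJ : a ∉ J := fun h => ha (hJ h)
  have hFn : F.Nonempty := by rw [← card_pos]; omega
  have hKJ : ∀ s, s ∈ (stel L F a).filter (· ⊆ insert a J) ↔
      (s ∈ L.filter (· ⊆ J) ∧ s ≠ F) ∨ (a ∈ s ∧ s.erase a ⊂ F ∧ s.erase a ⊆ J) := by
    intro s
    rw [mem_filter, mem_filter, hm]
    constructor
    · rintro ⟨h1 | h1, h2⟩
      · exact Or.inl ⟨⟨h1.2.1, (subset_insert_iff_of_notMem h1.1).mp h2⟩, h1.2.2⟩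
      · exact Or.inr ⟨h1.1, h1.2, subset_insert_iff.mp h2⟩
    · rintro (h1 | h1)
      · exact ⟨Or.inl ⟨haL s h1.1.1, h1.1.1, h1.2⟩, h1.1.2.trans (subset_insert _ _)⟩
      · exact ⟨Or.inr ⟨h1.1, h1.2.1⟩, subset_insert_iff.mpr h1.2.2⟩
  have hdnJ := hI.dn.filter J
  have haLJ : ∀ s ∈ L.filter (· ⊆ J), a ∉ s := fun s hs => haL s (mem_of_mem_filter _ hs)
  by_cases hG : (F ∩ J).Nonempty
  · have e1 : ¬ (e = 1 ∧ J ⊆ S \ F ∧ J ≠ ∅) := by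
      rintro ⟨-, h1, -⟩
      obtain ⟨x, hx⟩ := hG
      rw [mem_inter] at hx
      exact (mem_sdiff.mp (h1 hx.2)).2 hx.1
    have e2 : ¬ (e = 0 ∧ J = ∅) := by
      rintro ⟨-, rfl⟩; simp at hG
    rw [if_neg e1, if_neg e2, add_zero, sub_zero]
    by_cases hFJ : F ⊆ J
    · refine h_stel 𝕜 _ _ F a hdnJ haLJ (mem_filter.mpr ⟨hF, hFJ⟩) hFn ?_ ?_ e
      · intro s hs hFs
        exact (eq_of_subset_of_card_le hFs (by rw [hFc]; exact hI.cle s (mem_of_mem_filter _ hs))).symm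
      · intro s
        rw [hKJ]
        constructor
        · rintro (h | h)
          · exact Or.inl h
          · exact Or.inr ⟨h.1, h.2.1⟩
        · rintro (h | h)
          · exact Or.inl h
          · exact Or.inr ⟨h.1, h.2, h.2.1.trans hFJ⟩
    · refine (h_cone 𝕜 _ _ (F ∩ J) a hdnJ haLJ ?_ hG ?_).2 e
      · exact mem_filter.mpr ⟨hI.dn _ hF _ inter_subset_left, inter_subset_right⟩
      · intro s
        rw [hKJ, subset_inter_iff]
        constructor
        · rintro (h | h)
          · exact Or.inl h.1
          · exact Or.inr ⟨h.1, h.2.1.1, h.2.2⟩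
        · rintro (h | h)
          · exact Or.inl ⟨h, fun hs => hFJ (hs ▸ (mem_filter.mp h).2)⟩
          · refine Or.inr ⟨h.1, Finset.ssubset_iff_subset_ne.mpr ⟨h.2.1, fun hs => hFJ (hs ▸ h.2.2)⟩, h.2.2⟩
  · rw [not_nonempty_iff_eq_empty] at hG
    have hins : (stel L F a).filter (· ⊆ insert a J) = insert {a} (L.filter (· ⊆ J)) := by
      ext s
      rw [hKJ, mem_insert, or_comm]
      constructor
      · rintro (h | h)
        · left
          have : s.erase a ⊆ F ∩ J := subset_inter h.2.1.1 h.2.2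
          rw [hG, subset_empty] at this
          rw [← insert_erase h.1, this]; rfl
        · exact Or.inr h.1
      · rintro (h | h)
        · left; subst h
          rw [erase_singleton]
          exact ⟨mem_singleton_self a, empty_ssubset.mpr hFn, empty_subset _⟩
        · right
          refine ⟨h, ?_⟩
          rintro rfl
          rw [inter_eq_left.mpr (mem_filter.mp h).2] at hG
          exact hFn.ne_empty hG
    rw [hins]
    have hna : {a} ∉ L.filter (· ⊆ J) := fun h => haLJ _ h (mem_singleton_self a)
    by_cases hJe : J = ∅
    · subst hJe
      rw [filter_empty hI]
      have : (insert {a} {∅} : Finset (Finset V)) = ({a} : Finset V).powerset := by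
        ext s; simp [subset_singleton_iff, or_comm]
      rw [this, h_powerset 𝕜 _ (singleton_nonempty a), h_sing_empty]
      simp
    · have hJF : J ⊆ S \ F := by
        intro x hx
        refine mem_sdiff.mpr ⟨hJ hx, fun hxF => ?_⟩
        have : x ∈ F ∩ J := mem_inter.mpr ⟨hxF, hx⟩
        rw [hG] at this; simp at this
      rw [h_insert_mem 𝕜 _ _ hna]
      · simp [hJe, hJF]
      · obtain ⟨v, hv⟩ := nonempty_iff_ne_empty.mpr hJe
        refine Submodule.subset_span ⟨{v}, ⟨mem_filter.mpr ⟨hI.vert v (hJ hv), by simpa using hv⟩, by simp⟩, ?_⟩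
        simp [bd, sg, filter_singleton]

end step

/-- total Betti number -/
noncomputable def beta (L : Finset (Finset V)) (S : Finset V) (e j : ℕ) : ℤ :=
  ∑ J ∈ powersetCard j S, h 𝕜 (L.filter (· ⊆ J)) e

/-- closed formula -/
def B (n k e j : ℕ) : ℤ :=
  (if e = 0 ∧ j = 0 then 1 else 0) + (if e = n ∧ j = n + 1 + k then 1 else 0)
  + (if e = 1 then (((j - 1) * (k + 1).choose j : ℕ) : ℤ) else 0)
  + (if e + 1 = n ∧ n ≤ j then (((k - (j - n)) * (k + 1).choose (j - n) : ℕ) : ℤ) else 0)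

lemma B_zero (n k e : ℕ) (hn : 3 ≤ n) : B n k e 0 = if e = 0 then 1 else 0 := by
  unfold B
  have h1 : ¬ (e = n ∧ 0 = n + 1 + k) := by omega
  have h2 : ¬ (e + 1 = n ∧ n ≤ 0) := by omega
  rw [if_neg h1, if_neg h2]
  simp

lemma B_base (n e j : ℕ) : B n 0 e j =
    (if e = 0 ∧ j = 0 then 1 else 0) + (if e = n ∧ j = n + 1 then 1 else 0) := by
  have h1 : (j - 1) * (0 + 1).choose j = 0 := by
    rcases j with _ | _ | j
    · simp
    · simp
    · rw [Nat.choose_eq_zero_of_lt (by omega), mul_zero]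
  unfold B
  rw [h1]
  simp

lemma arith1 (k j : ℕ) : (((j + 1 - 1) * (k + 1 + 1).choose (j + 1) : ℕ) : ℤ) =
    (((j + 1 - 1) * (k + 1).choose (j + 1) : ℕ) : ℤ) + (((j - 1) * (k + 1).choose j : ℕ) : ℤ)
    + (((k + 1).choose j : ℤ) - if j = 0 then 1 else 0) := by
  rcases j with _ | j
  · simp
  · rw [Nat.choose_succ_succ (k + 1) (j + 1)]
    simp only [Nat.add_sub_cancel, Nat.add_eq_zero_iff, one_ne_zero, and_false, if_false]
    push_cast
    simp only [Nat.succ_eq_add_one]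
    ring

lemma arith2 (k q : ℕ) : (((k + 1 - (q + 1)) * (k + 1 + 1).choose (q + 1) : ℕ) : ℤ) =
    (((k - (q + 1)) * (k + 1).choose (q + 1) : ℕ) : ℤ) + (((k - q) * (k + 1).choose q : ℕ) : ℤ)
    + (((k + 1).choose (q + 1) : ℤ) - if q = k then 1 else 0) := by
  rcases lt_trichotomy q k with hq | hq | hq
  · obtain ⟨d, rfl⟩ : ∃ d, k = q + 1 + d := ⟨k - (q + 1), by omega⟩
    rw [Nat.choose_succ_succ (q + 1 + d + 1) q, if_neg (by omega)]
    have e1 : q + 1 + d + 1 - (q + 1) = d + 1 := by omega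
    have e2 : q + 1 + d - (q + 1) = d := by omega
    have e3 : q + 1 + d - q = d + 1 := by omega
    rw [e1, e2, e3]
    push_cast
    simp only [Nat.succ_eq_add_one]
    ring
  · subst hq; simp
  · have e1 : k + 1 - (q + 1) = 0 := by omega
    have e2 : k - (q + 1) = 0 := by omega
    have e3 : k - q = 0 := by omega
    rw [e1, e2, e3, if_neg (by omega), Nat.choose_eq_zero_of_lt (by omega : k + 1 < q + 1)]
    simp

lemma B_step (n k e j : ℕ) (hn : 3 ≤ n) : B n (k + 1) e (j + 1) = B n k e (j + 1) + B n k e j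
    + (if e + 1 = n then ((if n ≤ j + 1 then ((k + 1).choose (j + 1 - n) : ℤ) else 0) - if j + 1 = n + 1 + k then 1 else 0) else 0)
    - (if e = n ∧ j + 1 = n + 1 + k then 1 else 0)
    + (if e = 1 then (((k + 1).choose j : ℤ) - if j = 0 then 1 else 0) else 0)
    - (if e = 0 ∧ j = 0 then 1 else 0) := by
  have h2 := arith1 k j
  have h3 : (if n ≤ j + 1 then (((k + 1 - (j + 1 - n)) * (k + 1 + 1).choose (j + 1 - n) : ℕ) : ℤ) else 0) =
    (if n ≤ j + 1 then (((k - (j + 1 - n)) * (k + 1).choose (j + 1 - n) : ℕ) : ℤ) else 0)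
    + (if n ≤ j then (((k - (j - n)) * (k + 1).choose (j - n) : ℕ) : ℤ) else 0)
    + ((if n ≤ j + 1 then ((k + 1).choose (j + 1 - n) : ℤ) else 0) - if j + 1 = n + 1 + k then 1 else 0) := by
    rcases lt_trichotomy n (j + 1) with hj | hj | hj
    · obtain ⟨q, rfl⟩ : ∃ q, j = n + q := ⟨j - n, by omega⟩
      have e1 : n + q + 1 - n = q + 1 := by omega
      have e2 : n + q - n = q := by omega
      have e3 : (n + q + 1 = n + 1 + k) ↔ q = k := by omega
      simp only [e1, e2, e3, if_pos (by omega : n ≤ n + q + 1), if_pos (by omega : n ≤ n + q)]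
      exact arith2 k q
    · subst hj
      rw [if_pos le_rfl, if_pos le_rfl, if_pos le_rfl, if_neg (by omega), if_neg (by omega)]
      simp
    · rw [if_neg (by omega), if_neg (by omega), if_neg (by omega), if_neg (by omega), if_neg (by omega)]
      simp
  unfold B
  simp only [ite_and, Nat.add_eq_zero_iff, one_ne_zero, and_false, if_false]
  have c1 : (j + 1 = n + 1 + (k + 1)) ↔ j = n + 1 + k := by omega
  simp only [c1]
  by_cases he0 : e = 0
  · subst he0
    rw [if_neg (by omega : ¬ 0 = n), if_neg (by omega : ¬ 0 + 1 = n), if_neg (by omega : ¬ 0 + 1 = n)]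
    simp
    omega
  by_cases he1 : e = 1
  · subst he1
    have d1 : ¬ (1 = n) := by omega
    have d2 : ¬ (1 + 1 = n) := by omega
    simp only [d1, d2, one_ne_zero, if_false, if_true]
    linarith [h2]
  by_cases hen : e = n
  · subst hen
    have d2 : ¬ (e + 1 = e) := by omega
    simp only [he0, he1, d2, if_false, if_true]
    by_cases hh : j = e + 1 + k
    · have : ¬ (j + 1 = e + 1 + k) := by omega
      simp [hh]
    · simp [hh]
  by_cases hen1 : e + 1 = n
  · simp only [he0, he1, hen, hen1, if_false, if_true]
    linarith [h3]
  · simp only [he0, he1, hen, hen1, if_false]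
    simp

lemma count_sup {n k : ℕ} {S F : Finset V} (hS : S.card = n + 1 + k) (hF : F ⊆ S) (hFc : F.card = n) (j : ℕ) :
    ((powersetCard j S).filter (fun J => F ⊆ J)).card = if n ≤ j then (k + 1).choose (j - n) else 0 := by
  split_ifs with hj
  · have hc : (S \ F).card = k + 1 := by rw [card_sdiff_of_subset hF]; omega
    rw [← hc, ← card_powersetCard]
    refine card_bij' (fun J _ => J \ F) (fun J _ => J ∪ F) ?_ ?_ ?_ ?_
    · intro J hJ
      rw [mem_filter, mem_powersetCard] at hJ
      rw [mem_powersetCard]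
      exact ⟨sdiff_subset_sdiff hJ.1.1 subset_rfl, by rw [card_sdiff_of_subset hJ.2]; omega⟩
    · intro J hJ
      rw [mem_powersetCard] at hJ
      rw [mem_filter, mem_powersetCard]
      have hd : Disjoint J F := disjoint_of_subset_left hJ.1 sdiff_disjoint
      exact ⟨⟨union_subset (hJ.1.trans sdiff_subset) hF, by rw [card_union_of_disjoint hd]; omega⟩,
        subset_union_right⟩
    · intro J hJ
      rw [mem_filter] at hJ
      exact sdiff_union_of_subset hJ.2
    · intro J hJ
      rw [mem_powersetCard] at hJ
      have hd : Disjoint J F := disjoint_of_subset_left hJ.1 sdiff_disjoint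
      exact union_sdiff_cancel_right hd
  · rw [card_eq_zero, filter_eq_empty_iff]
    intro J hJ hFJ
    rw [mem_powersetCard] at hJ
    have := card_le_card hFJ
    omega

lemma count_eq (S T : Finset V) (hT : T ⊆ S) (j : ℕ) :
    (∑ J ∈ powersetCard j S, if J = T then (1 : ℤ) else 0) = if j = T.card then 1 else 0 := by
  rw [sum_ite_eq']
  simp only [mem_powersetCard, hT, true_and]
  congr 1
  exact propext eq_comm

lemma beta_zero {n k : ℕ} {S : Finset V} {L : Finset (Finset V)} (hI : Inv n k S L) (e : ℕ) :
    beta 𝕜 L S e 0 = if e = 0 then 1 else 0 := by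
  unfold beta
  rw [powersetCard_zero, sum_singleton, filter_empty hI, h_sing_empty]

lemma beta_step {n k : ℕ} {S : Finset V} {L : Finset (Finset V)} {F : Finset V} {a : V}
    (hn : 3 ≤ n) (hI : Inv n k S L) (hT : Top 𝕜 n L) (hF : F ∈ L) (hFc : F.card = n) (ha : a ∉ S)
    (e j : ℕ) : beta 𝕜 (stel L F a) (insert a S) e (j + 1) =
    beta 𝕜 L S e (j + 1) + beta 𝕜 L S e j
    + (if e + 1 = n then ((if n ≤ j + 1 then ((k + 1).choose (j + 1 - n) : ℤ) else 0) - if j + 1 = n + 1 + k then 1 else 0) else 0)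
    - (if e = n ∧ j + 1 = n + 1 + k then 1 else 0)
    + (if e = 1 then (((k + 1).choose j : ℤ) - if j = 0 then 1 else 0) else 0)
    - (if e = 0 ∧ j = 0 then 1 else 0) := by
  have hFS := hI.sub F hF
  unfold beta
  rw [powersetCard_succ_insert ha, sum_union, sum_image]
  rotate_left
  · intro J hJ J' hJ' hh
    rw [mem_coe, mem_powersetCard] at hJ hJ'
    rw [← erase_insert (fun h => ha (hJ.1 h)), hh, erase_insert (fun h => ha (hJ'.1 h))]
  · rw [disjoint_left]
    intro J hJ hJ'
    rw [mem_powersetCard] at hJ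
    obtain ⟨J', _, rfl⟩ := mem_image.mp hJ'
    exact ha (hJ.1 (mem_insert_self _ _))
  rw [sum_congr rfl (fun J hJ => hJ_out 𝕜 hn hI hT hF hFc ha J (mem_powersetCard.mp hJ).1 e),
    sum_congr rfl (fun J hJ => hJ_in 𝕜 hn hI hF hFc ha J (mem_powersetCard.mp hJ).1 e)]
  rw [sum_sub_distrib, sum_add_distrib, sum_sub_distrib, sum_add_distrib]
  have c1 : (∑ J ∈ powersetCard (j + 1) S, if e + 1 = n ∧ F ⊆ J ∧ J ≠ S then (1 : ℤ) else 0) =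
      (if e + 1 = n then ((if n ≤ j + 1 then ((k + 1).choose (j + 1 - n) : ℤ) else 0) - if j + 1 = n + 1 + k then 1 else 0) else 0) := by
    split_ifs with h1 <;> [skip; skip; skip; skip; simp [h1]]
    all_goals
      have h2 := count_sup hI.cardS hFS hFc (j + 1)
      have h3 := count_eq S S subset_rfl (j + 1)
      have h4 : (∑ J ∈ powersetCard (j + 1) S, if e + 1 = n ∧ F ⊆ J ∧ J ≠ S then (1 : ℤ) else 0) =
        (∑ J ∈ powersetCard (j + 1) S, if F ⊆ J then (1 : ℤ) else 0) -
        (∑ J ∈ powersetCard (j + 1) S, if J = S then (1 : ℤ) else 0) := by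
        rw [← sum_sub_distrib]
        refine sum_congr rfl fun J hJ => ?_
        by_cases hJS : J = S
        · subst hJS; simp [hFS]
        · simp [hJS, h1]
      rw [h4, h3, hI.cardS, sum_boole, h2]
      simp_all
  have c2 : (∑ J ∈ powersetCard (j + 1) S, if e = n ∧ J = S then (1 : ℤ) else 0) =
      (if e = n ∧ j + 1 = n + 1 + k then 1 else 0) := by
    by_cases h1 : e = n
    · have h3 := count_eq S S subset_rfl (j + 1)
      rw [hI.cardS] at h3
      simp only [h1, true_and]; exact h3
    · simp [h1]
  have c3 : (∑ J ∈ powersetCard j S, if e = 1 ∧ J ⊆ S \ F ∧ J ≠ ∅ then (1 : ℤ) else 0) =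
      (if e = 1 then (((k + 1).choose j : ℤ) - if j = 0 then 1 else 0) else 0) := by
    by_cases h1 : e = 1
    · have h3 := count_eq S ∅ (empty_subset _) j
      rw [card_empty] at h3
      have h4 : (∑ J ∈ powersetCard j S, if e = 1 ∧ J ⊆ S \ F ∧ J ≠ ∅ then (1 : ℤ) else 0) =
        (∑ J ∈ powersetCard j S, if J ⊆ S \ F then (1 : ℤ) else 0) -
        (∑ J ∈ powersetCard j S, if J = ∅ then (1 : ℤ) else 0) := by
        rw [← sum_sub_distrib]
        refine sum_congr rfl fun J hJ => ?_
        by_cases hJS : J = ∅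
        · subst hJS; simp
        · simp [hJS, h1]
      have h5 : (powersetCard j S).filter (fun J => J ⊆ S \ F) = powersetCard j (S \ F) := by
        ext J
        rw [mem_filter, mem_powersetCard, mem_powersetCard]
        constructor
        · exact fun h => ⟨h.2, h.1.2⟩
        · exact fun h => ⟨⟨h.1.trans sdiff_subset, h.2⟩, h.1⟩
      have hc : (S \ F).card = k + 1 := by rw [card_sdiff_of_subset hFS, hI.cardS]; omega
      rw [h4, h3, sum_boole, h5, card_powersetCard, hc, if_pos h1]
    · simp [h1]
  have c4 : (∑ J ∈ powersetCard j S, if e = 0 ∧ J = ∅ then (1 : ℤ) else 0) =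
      (if e = 0 ∧ j = 0 then 1 else 0) := by
    by_cases h1 : e = 0
    · have h3 := count_eq S ∅ (empty_subset _) j
      rw [card_empty] at h3
      simp only [h1, true_and]; exact h3
    · simp [h1]
  rw [c1, c2, c3, c4]
  ring

lemma beta_base (n : ℕ) (hn : 3 ≤ n) (S : Finset V) (hS : S.card = n + 1) (e j : ℕ) :
    beta 𝕜 S.ssubsets S e j = B n 0 e j := by
  have hI := inv_base n hn S hS
  have hT := top_base 𝕜 n hn S hS
  have hSn : S ≠ ∅ := by rintro rfl; simp at hS
  rw [B_base]
  have key : ∀ J ∈ powersetCard j S, h 𝕜 (S.ssubsets.filter (· ⊆ J)) e =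
      (if e = 0 then (if J = ∅ then 1 else 0) else 0) + (if e = n then (if J = S then 1 else 0) else 0) := by
    intro J hJ
    rw [mem_powersetCard] at hJ
    by_cases h1 : J = ∅
    · subst h1
      rw [filter_empty hI, h_sing_empty]
      simp [hSn.symm]
    · by_cases h2 : J = S
      · subst h2
        rw [filter_true_of_mem (fun s hs => hI.sub s hs), hT.whole]
        simp [h1]
      · have : S.ssubsets.filter (· ⊆ J) = J.powerset := by
          ext s
          rw [mem_filter, mem_powerset, mem_ssubsets]
          constructor
          · exact fun h => h.2
          · intro h
            exact ⟨lt_of_le_of_lt h (Finset.ssubset_iff_subset_ne.mpr ⟨hJ.1, h2⟩), h⟩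
        rw [this, h_powerset 𝕜 J (nonempty_iff_ne_empty.mpr h1)]
        simp [h1, h2]
  unfold beta
  rw [sum_congr rfl key, sum_add_distrib]
  have h3 := count_eq S ∅ (empty_subset _) j
  rw [card_empty] at h3
  have h4 := count_eq S S subset_rfl j
  rw [hS] at h4
  congr 1
  · by_cases h : e = 0
    · simp only [h, if_true, true_and]; exact h3
    · simp [h]
  · by_cases h : e = n
    · simp only [h, if_true, true_and]; exact h4
    · simp [h]

lemma St.beta_eq {n : ℕ} (hn : 3 ≤ n) {k : ℕ} {S : Finset V} {L : Finset (Finset V)} (hs : St n k S L) :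
    ∀ e j, beta 𝕜 L S e j = B n k e j := by
  induction hs with
  | base S hS => exact beta_base 𝕜 n hn S hS
  | step k S L F a hL hF hFc ha ih =>
    intro e j
    rcases j with _ | j
    · rw [B_zero n _ e hn, beta_zero 𝕜 ((St.step k S L F a hL hF hFc ha).inv hn)]
    · rw [B_step n k e j hn, ← ih, ← ih]
      exact beta_step 𝕜 hn (hL.inv hn) (hL.top 𝕜 hn) hF hFc ha e j

section bridge

/-- all faces of `K`, including the empty one -/
noncomputable def fam (K : SimComplex V) : Finset (Finset V) :=
  letI := Classical.propDecidable
  univ.filter (fun s => s = ∅ ∨ s ∈ K.faces)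

lemma mem_fam (K : SimComplex V) (s : Finset V) : s ∈ fam K ↔ s = ∅ ∨ s ∈ K.faces := by
  simp [fam]

lemma fam_restrict (K : SimComplex V) (J : Finset V) :
    fam (K.restrict J) = (fam K).filter (· ⊆ J) := by
  ext s
  rw [mem_filter, mem_fam, mem_fam]
  constructor
  · rintro (h | h)
    · subst h; exact ⟨Or.inl rfl, empty_subset _⟩
    · exact ⟨Or.inr h.1, h.2⟩
  · rintro ⟨h | h, h'⟩
    · exact Or.inl h
    · exact Or.inr ⟨h, h'⟩

/-- chain inclusion -/
noncomputable def inc (K : SimComplex V) (d : ℕ) : K.chains 𝕜 d →ₗ[𝕜] (Finset V →₀ 𝕜) :=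
  Finsupp.lmapDomain 𝕜 𝕜 (fun s : K.Face d => s.1)

lemma inc_inj (K : SimComplex V) (d : ℕ) : Function.Injective (inc 𝕜 K d) :=
  Finsupp.mapDomain_injective Subtype.val_injective

lemma inc_single (K : SimComplex V) (d : ℕ) (s : K.Face d) (c : 𝕜) :
    inc 𝕜 K d (Finsupp.single s c) = Finsupp.single s.1 c := by
  simp [inc, Finsupp.mapDomain_single]

lemma inc_faceBoundary (K : SimComplex V) (d : ℕ) (s : K.Face (d + 1)) :
    inc 𝕜 K d (K.faceBoundary 𝕜 d s) = bd 𝕜 s.1 := by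
  unfold SimComplex.faceBoundary bd
  rw [map_sum]
  rw [← Finset.sum_attach s.1 (fun a => sg 𝕜 a s.1 • Finsupp.single (s.1.erase a) (1 : 𝕜))]
  refine sum_congr rfl fun a _ => ?_
  rw [map_smul]
  congr 1
  exact inc_single 𝕜 K d _ 1

lemma inc_boundary (K : SimComplex V) (d : ℕ) (x : K.chains 𝕜 (d + 1)) :
    inc 𝕜 K d (K.boundary 𝕜 d x) = DD 𝕜 (inc 𝕜 K (d + 1) x) := by
  induction x using Finsupp.induction_linear with
  | zero => simp
  | add f g hf hg => simp only [map_add, hf, hg]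
  | single s c =>
    rw [inc_single]
    simp [SimComplex.boundary, DD, inc_faceBoundary]

lemma inc_aug (K : SimComplex V) (x : K.chains 𝕜 0) :
    Finsupp.single ∅ (K.augmentation 𝕜 x) = DD 𝕜 (inc 𝕜 K 0 x) := by
  induction x using Finsupp.induction_linear with
  | zero => simp
  | add f g hf hg => simp only [map_add, Finsupp.single_add, hf, hg]
  | single s c =>
    rw [inc_single]
    obtain ⟨v, hv⟩ := card_eq_one.mp s.2.2
    simp [SimComplex.augmentation, DD, hv, bd, sg, filter_singleton]

lemma DD_DD (x : Finset V →₀ 𝕜) : DD 𝕜 (DD 𝕜 x) = 0 := by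
  induction x using Finsupp.induction_linear with
  | zero => simp
  | add f g hf hg => simp only [map_add, hf, hg, add_zero]
  | single s c =>
    have : DD 𝕜 (Finsupp.single s c) = c • bd 𝕜 s := by simp [DD]
    rw [this, map_smul, DD_bd, smul_zero]

lemma mem_cycles (K : SimComplex V) (d : ℕ) (x : K.chains 𝕜 d) :
    x ∈ K.cycles 𝕜 d ↔ x ∈ LinearMap.ker (DD 𝕜 ∘ₗ inc 𝕜 K d) := by
  rw [LinearMap.mem_ker, LinearMap.comp_apply]
  cases d with
  | zero =>
    unfold SimComplex.cycles
    rw [LinearMap.mem_ker, ← inc_aug]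
    simp
  | succ d =>
    unfold SimComplex.cycles
    rw [LinearMap.mem_ker, ← inc_boundary]
    exact (map_eq_zero_iff _ (inc_inj 𝕜 K d)).symm

lemma range_le (K : SimComplex V) (d : ℕ) : LinearMap.range (K.boundary 𝕜 d) ≤ K.cycles 𝕜 d := by
  rintro _ ⟨x, rfl⟩
  rw [mem_cycles, LinearMap.mem_ker, LinearMap.comp_apply, inc_boundary, DD_DD]

lemma range_eq (K : SimComplex V) (d : ℕ) :
    LinearMap.range (DD 𝕜 ∘ₗ inc 𝕜 K d) = bs 𝕜 (fam K) (d + 1) := by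
  have h1 : DD 𝕜 ∘ₗ inc 𝕜 K d = Finsupp.linearCombination 𝕜 (fun s : K.Face d => bd 𝕜 s.1) := by
    apply Finsupp.lhom_ext
    intro s c
    rw [LinearMap.comp_apply, inc_single]
    simp [DD]
  rw [h1, Finsupp.range_linearCombination]
  unfold bs
  congr 1
  ext x
  constructor
  · rintro ⟨s, rfl⟩
    exact ⟨s.1, ⟨(mem_fam K _).mpr (Or.inr s.2.1), s.2.2⟩, rfl⟩
  · rintro ⟨s, ⟨h2, h3⟩, rfl⟩
    rcases (mem_fam K s).mp h2 with h | h
    · subst h; simp at h3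
    · exact ⟨⟨s, h, h3⟩, rfl⟩

noncomputable instance instFace (K : SimComplex V) (d : ℕ) : Fintype (K.Face d) := by
  unfold SimComplex.Face
  classical
  infer_instance

lemma card_Face (K : SimComplex V) (d : ℕ) :
    Fintype.card (K.Face d) = ((fam K).filter (fun s => s.card = d + 1)).card := by
  rw [← Fintype.card_coe]
  refine Fintype.card_congr ⟨fun s => ⟨s.1, ?_⟩, fun s => ⟨s.1, ?_⟩, fun s => rfl, fun s => rfl⟩
  · rw [mem_filter, mem_fam]
    exact ⟨Or.inr s.2.1, s.2.2⟩
  · have := s.2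
    rw [mem_filter, mem_fam] at this
    refine ⟨?_, this.2⟩
    rcases this.1 with h | h
    · rw [h] at this; simp at this
    · exact h

lemma hdimNat_eq (K : SimComplex V) (d : ℕ) : (K.hdimNat 𝕜 d : ℤ) = h 𝕜 (fam K) (d + 1) := by
  unfold SimComplex.hdimNat
  rw [inf_eq_left.mpr (range_le 𝕜 K d)]
  have h1 := Submodule.finrank_mono (range_le 𝕜 K d)
  rw [Nat.cast_sub h1]
  have h2 : K.cycles 𝕜 d = LinearMap.ker (DD 𝕜 ∘ₗ inc 𝕜 K d) := by
    ext x; exact mem_cycles 𝕜 K d x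
  have h3 := LinearMap.finrank_range_add_finrank_ker (DD 𝕜 ∘ₗ inc 𝕜 K d)
  rw [← h2, range_eq, finrank_finsupp_self, card_Face] at h3
  have h4 : finrank 𝕜 (LinearMap.range (K.boundary 𝕜 d)) = finrank 𝕜 (bs 𝕜 (fam K) (d + 2)) := by
    rw [← range_eq 𝕜 K (d + 1)]
    have : DD 𝕜 ∘ₗ inc 𝕜 K (d + 1) = inc 𝕜 K d ∘ₗ K.boundary 𝕜 d := by
      ext1 x; ext1; simp [inc_boundary]
    rw [this, LinearMap.range_comp]
    exact (LinearEquiv.finrank_eq (Submodule.equivMapOfInjective _ (inc_inj 𝕜 K d) _))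
  unfold h r
  rw [h4]
  push_cast [← h3]
  ring

lemma hdim_eq (K : SimComplex V) (e : ℕ) : (K.hdim 𝕜 ((e : ℤ) - 1) : ℤ) = h 𝕜 (fam K) e := by
  unfold SimComplex.hdim
  rcases e with _ | e
  · simp only [Nat.cast_zero, zero_sub, if_true]
    have h0 : ((fam K).filter (fun s => s.card = 0)).card = 1 := by
      rw [card_eq_one]
      refine ⟨∅, ?_⟩
      ext s; rw [mem_filter, mem_fam, mem_singleton, card_eq_zero]; tauto
    have hr0 : r 𝕜 (fam K) 0 = 0 := by
      have : bs 𝕜 (fam K) 0 = ⊥ := by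
        unfold bs
        rw [Submodule.span_eq_bot]
        rintro _ ⟨s, ⟨h1, h2⟩, rfl⟩
        rw [card_eq_zero] at h2
        subst h2; simp [bd]
      unfold r; rw [this, finrank_bot]
    unfold h
    rw [h0, hr0]
    have hbd : ∀ s : Finset V, s.card = 1 → bd 𝕜 s = Finsupp.single ∅ 1 := by
      intro s hs
      obtain ⟨v, rfl⟩ := card_eq_one.mp hs
      simp [bd, sg, filter_singleton]
    split_ifs with hK
    · have : bs 𝕜 (fam K) 1 = ⊥ := by
        unfold bs
        rw [Submodule.span_eq_bot]
        rintro _ ⟨s, ⟨h1, h2⟩, rfl⟩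
        rw [mem_fam, hK] at h1
        rcases h1 with h | h
        · subst h; simp at h2
        · simp at h
      unfold r; rw [zero_add, this, finrank_bot]; simp
    · obtain ⟨s, hs⟩ := Set.nonempty_iff_ne_empty.mpr hK
      have hsn : s.Nonempty := nonempty_iff_ne_empty.mpr (fun h => K.not_empty_mem (h ▸ hs))
      obtain ⟨v, hv⟩ := hsn
      have hvK : {v} ∈ K.faces := K.down_closed hs (by simpa using hv) (singleton_nonempty v)
      have : bs 𝕜 (fam K) 1 = Submodule.span 𝕜 {Finsupp.single ∅ 1} := by
        unfold bs
        congr 1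
        ext x
        constructor
        · rintro ⟨t, ⟨_, h2⟩, rfl⟩
          exact hbd t h2
        · rintro rfl
          exact ⟨{v}, ⟨(mem_fam K _).mpr (Or.inr hvK), by simp⟩, hbd _ (by simp)⟩
      unfold r
      rw [zero_add, this, finrank_span_singleton (by simp)]; simp
  · have e1 : ((e + 1 : ℕ) : ℤ) - 1 = e := by push_cast; ring
    rw [e1, if_neg (by omega), if_pos (by omega), Int.toNat_natCast]
    exact hdimNat_eq 𝕜 K e

lemma bbetti_eq (K : SimComplex V) (e i : ℕ) : (K.bbetti 𝕜 i (i + e) : ℤ) = beta 𝕜 (fam K) univ e (i + e) := by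
  unfold SimComplex.bbetti beta
  push_cast
  refine sum_congr rfl fun J _ => ?_
  rw [← fam_restrict, ← hdim_eq]
  congr 2
  ring

lemma bbetti_lt (K : SimComplex V) (i j : ℕ) (hij : j < i) : K.bbetti 𝕜 i j = 0 := by
  unfold SimComplex.bbetti
  refine sum_eq_zero fun J _ => ?_
  unfold SimComplex.hdim
  rw [if_neg (by omega), if_neg (by omega)]

end bridge
end alg

section trans
variable {V : Type} [Fintype V] [LinearOrder V]

/-- image of the vertex set -/
noncomputable def imS {W : Type} (f : W ↪ V) : Finset V :=
  letI := Classical.propDecidable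
  univ.filter (fun v => v ∈ Set.range f)

/-- image of the complex -/
noncomputable def imF {W : Type} (f : W ↪ V) (K : SimComplex W) : Finset (Finset V) :=
  letI := Classical.propDecidable
  univ.filter (fun s => s = ∅ ∨ ∃ t ∈ K.faces, t.map f = s)

lemma mem_imS {W : Type} (f : W ↪ V) (v : V) : v ∈ imS f ↔ ∃ w, f w = v := by
  simp [imS]

lemma mem_imF {W : Type} (f : W ↪ V) (K : SimComplex W) (s : Finset V) :
    s ∈ imF f K ↔ s = ∅ ∨ ∃ t ∈ K.faces, t.map f = s := by
  simp [imF]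

lemma map_mem_imF {W : Type} (f : W ↪ V) (K : SimComplex W) (t : Finset W) :
    t.map f ∈ imF f K ↔ t = ∅ ∨ t ∈ K.faces := by
  rw [mem_imF, map_eq_empty]
  constructor
  · rintro (h | ⟨t', h, h'⟩)
    · exact Or.inl h
    · rw [map_inj] at h'; exact Or.inr (h' ▸ h)
  · rintro (h | h)
    · exact Or.inl h
    · exact Or.inr ⟨t, h, rfl⟩

lemma iso_im {W U : Type} (K : SimComplex W) (L : SimComplex U) (e : W ≃ U)
    (he : ∀ s : Finset W, s ∈ K.faces ↔ s.map e.toEmbedding ∈ L.faces) (f : U ↪ V) :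
    imS f = imS (e.toEmbedding.trans f) ∧ imF f L = imF (e.toEmbedding.trans f) K := by
  constructor
  · ext v
    rw [mem_imS, mem_imS]
    constructor
    · rintro ⟨w, rfl⟩; exact ⟨e.symm w, by simp⟩
    · rintro ⟨w, rfl⟩; exact ⟨e w, rfl⟩
  · ext s
    rw [mem_imF, mem_imF]
    refine or_congr Iff.rfl ?_
    constructor
    · rintro ⟨t, ht, rfl⟩
      refine ⟨t.map e.symm.toEmbedding, ?_, ?_⟩
      · rw [he, Finset.map_map]
        simpa using ht
      · rw [Finset.map_map]
        congr 1
        ext x; simp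
    · rintro ⟨t, ht, rfl⟩
      exact ⟨t.map e.toEmbedding, (he t).mp ht, by rw [Finset.map_map]⟩

lemma exists_map {W : Type} (f : W ↪ V) (s : Finset V) (hs : ∀ x ∈ s, ∃ w, f w = x) :
    ∃ t : Finset W, t.map f = s := by
  refine ⟨s.preimage f f.injective.injOn, ?_⟩
  ext x
  simp only [mem_map, mem_preimage]
  constructor
  · rintro ⟨w, h, rfl⟩; exact h
  · intro h
    obtain ⟨w, rfl⟩ := hs x h
    exact ⟨w, h, rfl⟩

lemma trans_base (n : ℕ) (f : (Σ p : Fin 1, Fin ((![n] : Fin 1 → ℕ) p + 1)) ↪ V) :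
    St n 0 (imS f) (imF f (SimComplex.prodSimplicesDual 1 ![n])) := by
  have hS : imS f = univ.map f := by
    ext v; rw [mem_imS]; simp
  have hF : imF f (SimComplex.prodSimplicesDual 1 ![n]) = (imS f).ssubsets := by
    ext s
    rw [mem_imF, mem_ssubsets]
    constructor
    · rintro (rfl | ⟨t, ⟨h1, h2⟩, rfl⟩)
      · rw [hS]
        exact empty_ssubset.mpr ⟨f ⟨0, 0⟩, by simp⟩
      · obtain ⟨q, hq⟩ := h2 0
        rw [hS, map_ssubset_map, Finset.ssubset_iff_subset_ne]
        exact ⟨subset_univ _, fun h => hq (h ▸ mem_univ _)⟩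
    · intro h
      rcases s.eq_empty_or_nonempty with h0 | h0
      · exact Or.inl h0
      right
      obtain ⟨t, rfl⟩ := exists_map f s (fun x hx => (mem_imS f x).mp (h.1 hx))
      refine ⟨t, ⟨by simpa using h0, ?_⟩, rfl⟩
      rw [hS, map_ssubset_map] at h
      obtain ⟨⟨p, q⟩, _, hx⟩ := exists_of_ssubset h
      intro p'
      obtain rfl : p = p' := Subsingleton.elim _ _
      exact ⟨q, hx⟩
  rw [hF]
  apply St.base
  rw [hS, card_map, card_univ, Fintype.card_sigma]
  simp

lemma map_some_erase {W : Type} (f : Option W ↪ V) (s : Finset (Option W)) :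
    (s.eraseNone).map (Function.Embedding.some.trans f) = (s.map f).erase (f none) := by
  ext x
  simp only [mem_map, mem_eraseNone, mem_erase]
  constructor
  · rintro ⟨w, hw, rfl⟩
    refine ⟨?_, some w, hw, rfl⟩
    intro h
    have := f.injective h
    simp at this
  · rintro ⟨h, w, hw, rfl⟩
    rcases w with _ | w
    · exact absurd rfl h
    · exact ⟨w, hw, rfl⟩

lemma trans_main (n : ℕ) (hn : 3 ≤ n) : ∀ (k : ℕ) (W : Type) (K : SimComplex W),
    IsGenTruncCx 1 ![n] k W K → ∀ f : W ↪ V, St n k (imS f) (imF f K) := by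
  intro k
  induction k with
  | zero =>
    rintro W K ⟨e, he⟩ f
    obtain ⟨h1, h2⟩ := iso_im _ K e he f
    rw [h1, h2]
    exact trans_base n _
  | succ k ih =>
    rintro U K ⟨W, L, F, hL, hF, e, he⟩ f0
    obtain ⟨h1, h2⟩ := iso_im _ K e he f0
    rw [h1, h2]
    generalize e.toEmbedding.trans f0 = f
    set f' : W ↪ V := Function.Embedding.some.trans f with hf'
    have hst := ih W L hL f'
    have hI := hst.inv hn
    have haS : f none ∉ imS f' := by
      rw [mem_imS]
      rintro ⟨w, hw⟩
      have := f.injective hw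
      simp at this
    have hSS : imS f = insert (f none) (imS f') := by
      ext v
      rw [mem_insert, mem_imS, mem_imS]
      constructor
      · rintro ⟨w, rfl⟩
        rcases w with _ | w
        · exact Or.inl rfl
        · exact Or.inr ⟨w, rfl⟩
      · rintro (h | ⟨w, rfl⟩)
        · exact ⟨none, h.symm⟩
        · exact ⟨some w, rfl⟩
    have hFm : F.map f' ∈ imF f' L := (map_mem_imF f' L F).mpr (Or.inr hF.1)
    have hFc : (F.map f').card = n := by
      obtain ⟨G, hG, hFG, hGc⟩ := hI.pure _ hFm
      rcases (mem_imF f' L G).mp hG with h | ⟨t, ht, rfl⟩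
      · rw [h] at hGc; simp at hGc; omega
      · rw [map_subset_map] at hFG
        rw [← hF.2 t ht hFG]; exact hGc
    have haL : ∀ s ∈ imF f' L, f none ∉ s := fun s hs h => haS (hI.sub s hs h)
    have haF := haL _ hFm
    have hFF : imF f (SimComplex.stellar L F) = stel (imF f' L) (F.map f') (f none) := by
      ext s
      rw [mem_stel _ _ _ haF haL]
      by_cases hs : ∀ x ∈ s, ∃ w, f w = x
      · obtain ⟨t, rfl⟩ := exists_map f s hs
        rw [map_mem_imF, ← map_some_erase, map_ssubset_map, mem_map']
        have hne : none ∉ t → t.map f = (t.eraseNone).map f' := by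
          intro h
          rw [map_some_erase, erase_eq_of_notMem (by rwa [mem_map'])]
        have hempty : none ∉ t → t.eraseNone = ∅ → t = ∅ := by
          intro h h'
          have := hne h
          rw [h', map_empty, map_eq_empty] at this
          exact this
        constructor
        · rintro (h | ⟨h, h' | h'⟩)
          · subst h
            left
            refine ⟨by simp, (mem_imF _ _ _).mpr (Or.inl (map_empty _)), ?_⟩
            intro h
            rw [← h] at hFc; simp at hFc; omega
          · left
            refine ⟨h'.1, ?_, ?_⟩
            · rw [hne h'.1, map_mem_imF]; exact Or.inr h'.2.1
            · rw [hne h'.1, Ne, map_inj]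
              intro h3; exact h'.2.2 (h3 ▸ subset_rfl)
          · exact Or.inr ⟨h'.1, h'.2.1⟩
        · rintro (⟨h, h', h''⟩ | ⟨h, h'⟩)
          · rw [hne h, map_mem_imF] at h'
            rw [hne h, Ne, map_inj] at h''
            rcases h' with h' | h'
            · exact Or.inl (hempty h h')
            · right
              refine ⟨?_, Or.inl ⟨h, h', fun h3 => h'' (hF.2 _ h' h3)⟩⟩
              rw [nonempty_iff_ne_empty]
              rintro rfl
              exact L.not_empty_mem (by simpa using h')
          · right
            refine ⟨⟨_, h⟩, Or.inr ⟨h, h', ?_⟩⟩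
            rcases (t.eraseNone).eq_empty_or_nonempty with h0 | h0
            · exact Or.inr h0
            · exact Or.inl (L.down_closed hF.1 h'.1 h0)
      · constructor
        · intro h
          exfalso; apply hs
          rcases (mem_imF _ _ _).mp h with h | ⟨t, _, rfl⟩
          · subst h; simp
          · intro x hx
            obtain ⟨w, _, rfl⟩ := mem_map.mp hx
            exact ⟨w, rfl⟩
        · intro h
          exfalso; apply hs
          have hsub : s ⊆ insert (f none) (imS f') := by
            rcases h with h | h
            · exact (hI.sub s h.2.1).trans (subset_insert _ _)
            · rw [← insert_erase h.1]
              exact insert_subset_insert _ (h.2.1.trans (hI.sub _ hFm))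
          rw [← hSS] at hsub
          exact fun x hx => (mem_imS f x).mp (hsub hx)
    rw [hSS, hFF]
    exact St.step k _ _ _ _ hst hFm hFc haS

lemma trans_final (n : ℕ) (hn : 3 ≤ n) (k : ℕ) (K : SimComplex V) (hK : IsGenTruncCx 1 ![n] k V K) :
    St n k univ (fam K) := by
  have := trans_main n hn k V K hK (Function.Embedding.refl V)
  have h1 : imS (Function.Embedding.refl V) = univ := by
    ext v; rw [mem_imS]; simp
  have h2 : imF (Function.Embedding.refl V) K = fam K := by
    ext s; rw [mem_imF, mem_fam]; simp
  rwa [h1, h2] at this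

end trans
end Stk
/-- **Bigraded Betti numbers of truncation polytopes** (Terai–Hibi; see also Limonchenko,
Proposition 2.6).  Let `P = vc^k(Δ^n)` be a truncation polytope with `n ≥ 3`, `k ≥ 0`,
with `m = n + 1 + k` facets, and `K = K_P` its dual boundary complex.  Over a field `𝕜`
of characteristic zero:
(a) `β^{-i,2(i+1)}(P) = i·C(k+1, i+1)`;
(b) `β^{-i,2(i+n-1)}(P) = (k+1-i)·C(k+1, k+2-i)`;
(c) `β^{-i,2j}(P) = 0` for `i + 1 < j < i + n - 1`;
(d) `β^{0,0}(P) = β^{-(m-n),2m}(P) = 1`;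
and all other bigraded Betti numbers vanish. -/
theorem truncationPolytope_bigraded_betti
    (n k : ℕ) (hn : 3 ≤ n)
    {V : Type} [Fintype V] [LinearOrder V] (K : SimComplex V)
    (hK : IsGenTruncCx 1 ![n] k V K)
    (𝕜 : Type) [Field 𝕜] [CharZero 𝕜]
    (m : ℕ) (hm : m = n + 1 + k) :
    (∀ i : ℕ, K.bbetti 𝕜 i (i + 1) = i * (k + 1).choose (i + 1)) ∧
    (∀ i : ℕ, K.bbetti 𝕜 i (i + n - 1) = (k + 1 - i) * (k + 1).choose (k + 2 - i)) ∧
    (∀ i j : ℕ, i + 1 < j → j < i + n - 1 → K.bbetti 𝕜 i j = 0) ∧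
    (K.bbetti 𝕜 0 0 = 1 ∧ K.bbetti 𝕜 (m - n) m = 1) ∧
    (∀ i j : ℕ, K.bbetti 𝕜 i j ≠ 0 →
      (i = 0 ∧ j = 0) ∨ (i = m - n ∧ j = m) ∨ (i + 1 ≤ j ∧ j ≤ i + n - 1)) := by
  have hst := Stk.trans_final n hn k K hK
  have key : ∀ i e, (K.bbetti 𝕜 i (i + e) : ℤ) = Stk.B n k e (i + e) := fun i e => by
    rw [Stk.bbetti_eq, hst.beta_eq 𝕜 hn]
  have hmn : m - n = k + 1 := by omega
  refine ⟨?_, ?_, ?_, ⟨?_, ?_⟩, ?_⟩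
  · intro i
    have h1 := key i 1
    unfold Stk.B at h1
    rw [if_neg (by omega), if_neg (by omega), if_pos rfl, if_neg (by omega)] at h1
    rw [zero_add, zero_add, add_zero, Nat.add_sub_cancel] at h1
    exact_mod_cast h1
  · intro i
    have e1 : i + n - 1 = i + (n - 1) := by omega
    rw [e1]
    have h1 := key i (n - 1)
    unfold Stk.B at h1
    rw [if_neg (by omega), if_neg (by omega), if_neg (by omega)] at h1
    rcases i with _ | p
    · rw [if_neg (by omega)] at h1
      rw [Nat.choose_eq_zero_of_lt (by omega), mul_zero]
      exact_mod_cast h1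
    · rw [if_pos (by omega)] at h1
      have e2 : p + 1 + (n - 1) - n = p := by omega
      rw [e2] at h1
      have h2 : K.bbetti 𝕜 (p + 1) (p + 1 + (n - 1)) = (k - p) * (k + 1).choose p := by
        rw [add_zero, add_zero, zero_add] at h1
        exact_mod_cast h1
      rw [h2]
      have e3 : k + 1 - (p + 1) = k - p := by omega
      rw [e3]
      by_cases hp : p ≤ k + 1
      · rw [← Nat.choose_symm hp]
        congr 2
        omega
      · have : k - p = 0 := by omega
        rw [this, zero_mul, zero_mul]
  · intro i j h1 h2
    obtain ⟨e, rfl⟩ : ∃ e, j = i + e := ⟨j - i, by omega⟩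
    have h3 := key i e
    unfold Stk.B at h3
    rw [if_neg (by omega), if_neg (by omega), if_neg (by omega), if_neg (by omega)] at h3
    exact_mod_cast h3
  · have h3 := key 0 0
    rw [Stk.B_zero n k 0 hn] at h3
    exact_mod_cast h3
  · have e1 : m = k + 1 + n := by omega
    rw [hmn, e1]
    have h3 := key (k + 1) n
    unfold Stk.B at h3
    rw [if_neg (by omega), if_pos (by omega), if_neg (by omega), if_neg (by omega)] at h3
    exact_mod_cast h3
  · intro i j hne
    by_contra hcon
    apply hne
    rcases lt_or_ge j i with hij | hij
    · exact Stk.bbetti_lt 𝕜 K i j hij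
    obtain ⟨e, rfl⟩ : ∃ e, j = i + e := ⟨j - i, by omega⟩
    have h3 := key i e
    unfold Stk.B at h3
    rw [if_neg (by omega), if_neg (by omega), if_neg (by omega), if_neg (by omega)] at h3
    exact_mod_cast h3
end

section
/- Let P = vc^k(Δ^2) be a (k+3)-gon, k ≥ 0. Then over a field k of characteristic zero: (a) β^{-i,2(i+1)}(P) = i·C(k+1, i+1) + (k+1−i)·C(k+1, k+2−i); (b) β^{0,0}(P) = β^{-(k+1),2(k+3)}(P) = 1; and all other bigraded Betti numbers are zero. -/
open Finset Module

namespace SimComplex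

/-- two distinct vertices lie in a common face -/
def PAdj {V : Type*} (K : SimComplex V) (v w : V) : Prop :=
  v ≠ w ∧ ∃ s ∈ K.faces, v ∈ s ∧ w ∈ s

/-- `K` is (combinatorially) an `m`-cycle -/
structure IsPoly {V : Type*} (K : SimComplex V) (m : ℕ) : Prop where
  fin : Finite V
  card : Nat.card V = m
  sing : ∀ v, {v} ∈ K.faces
  le2 : ∀ s ∈ K.faces, s.card ≤ 2
  reg : ∀ v, ∃ p q, p ≠ q ∧ ∀ w, K.PAdj v w ↔ w = p ∨ w = q
  conn : ∀ J : Set V, J.Nonempty → J ≠ Set.univ → ∃ v ∈ J, ∃ w, w ∉ J ∧ K.PAdj v w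

theorem PAdj.symm {V : Type*} {K : SimComplex V} {v w : V} (h : K.PAdj v w) : K.PAdj w v := by
  obtain ⟨h, s, hs, h1, h2⟩ := h
  exact ⟨h.symm, s, hs, h2, h1⟩

theorem iso_padj {V W : Type*} {K : SimComplex V} {L : SimComplex W} (e : V ≃ W)
    (he : ∀ s : Finset V, s ∈ K.faces ↔ s.map e.toEmbedding ∈ L.faces) (v w : V) :
    K.PAdj v w ↔ L.PAdj (e v) (e w) := by
  constructor
  · rintro ⟨h, s, hs, h1, h2⟩
    exact ⟨e.injective.ne h, _, (he s).1 hs, by simpa using h1, by simpa using h2⟩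
  · rintro ⟨h, s, hs, h1, h2⟩
    refine ⟨fun h' => h (by rw [h']), s.map e.symm.toEmbedding, ?_, ?_, ?_⟩
    · rw [he, Finset.map_map]
      convert hs
      ext x
      simp
    · exact Finset.mem_map.2 ⟨_, h1, by simp⟩
    · exact Finset.mem_map.2 ⟨_, h2, by simp⟩

theorem IsPoly.iso {V W : Type*} {K : SimComplex V} {L : SimComplex W} {m : ℕ}
    (hK : K.IsPoly m) (h : Iso K L) : L.IsPoly m := by
  obtain ⟨e, he⟩ := h
  have hadj := iso_padj e he
  have := hK.fin
  refine ⟨Finite.of_equiv V e, ?_, ?_, ?_, ?_, ?_⟩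
  · rw [← Nat.card_congr e, hK.card]
  · intro v
    have := (he _).1 (hK.sing (e.symm v))
    simpa using this
  · intro s hs
    have h1 : (s.map e.symm.toEmbedding) ∈ K.faces := by
      rw [he, Finset.map_map]
      convert hs
      ext x
      simp
    have := hK.le2 _ h1
    simpa using this
  · intro v
    obtain ⟨p, q, hpq, h⟩ := hK.reg (e.symm v)
    refine ⟨e p, e q, e.injective.ne hpq, fun w => ?_⟩
    have := h (e.symm w)
    rw [hadj] at this
    simp only [Equiv.apply_symm_apply] at this
    rw [this, Equiv.symm_apply_eq, Equiv.symm_apply_eq]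
  · intro J hJ hJ'
    obtain ⟨v, hv, w, hw, h⟩ := hK.conn (e ⁻¹' J) (by
      obtain ⟨x, hx⟩ := hJ
      exact ⟨e.symm x, by simpa using hx⟩) (by
      intro h
      apply hJ'
      ext x
      have : e.symm x ∈ e ⁻¹' J := by rw [h]; trivial
      simpa using this)
    exact ⟨e v, hv, e w, hw, (hadj _ _).1 h⟩

theorem isPoly_base : (prodSimplicesDual 1 ![2]).IsPoly 3 := by
  have hadj : ∀ v w, (prodSimplicesDual 1 ![2]).PAdj v w ↔ v ≠ w := by
    intro v w
    refine ⟨fun h => h.1, fun h => ⟨h, {v, w}, ⟨⟨v, by simp⟩, ?_⟩, by simp, by simp⟩⟩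
    revert v w
    decide
  refine ⟨inferInstance, ?_, ?_, ?_, ?_, ?_⟩
  · rw [Nat.card_eq_fintype_card]; decide
  · intro v
    refine ⟨⟨v, by simp⟩, ?_⟩
    revert v
    decide
  · rintro s ⟨-, hs⟩
    revert s
    decide
  · simp only [hadj]
    decide
  · intro J ⟨v, hv⟩ hJ
    obtain ⟨w, hw⟩ := (Set.ne_univ_iff_exists_notMem J).1 hJ
    exact ⟨v, hv, w, hw, (hadj _ _).2 (by rintro rfl; exact hw hv)⟩

theorem IsPoly.stellar {V : Type*} {K : SimComplex V} {m : ℕ}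
    (hK : K.IsPoly m) {F : Finset V} (hF : K.IsFacet F) :
    (SimComplex.stellar K F).IsPoly (m + 1) := by
  classical
  have hF2 : F.card = 2 := by
    have h1 := hK.le2 F hF.1
    have h0 : F.card ≠ 0 := by
      intro h
      rw [Finset.card_eq_zero] at h
      exact K.not_empty_mem (h ▸ hF.1)
    by_contra h2
    have h3 : F.card = 1 := by omega
    obtain ⟨v, rfl⟩ := Finset.card_eq_one.1 h3
    obtain ⟨p, q, -, h⟩ := hK.reg v
    obtain ⟨hvp, s, hs, hv, hp⟩ := (h p).2 (Or.inl rfl)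
    have := hF.2 s hs (by simpa using hv)
    rw [this] at hp
    simp at hp
    exact hvp hp.symm
  have sub2 : ∀ {u w : V} {s : Finset V}, u ≠ w → u ∈ s → w ∈ s → s.card ≤ 2 → s = {u, w} := by
    intro u w s huw hu hw hs
    symm
    apply Finset.eq_of_subset_of_card_le
    · intro x hx
      simp at hx
      rcases hx with rfl | rfl <;> assumption
    · rw [Finset.card_pair huw]; exact hs
  have cardE : ∀ s : Finset (Option V), none ∉ s → s.eraseNone.card = s.card := by
    intro s hs
    rw [← Finset.card_map Function.Embedding.some, Finset.map_some_eraseNone, Finset.erase_eq_of_notMem hs]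
  have cardE' : ∀ s : Finset (Option V), none ∈ s → s.eraseNone.card + 1 = s.card := by
    intro s hs
    rw [← Finset.card_map Function.Embedding.some, Finset.map_some_eraseNone, Finset.card_erase_add_one hs]
  have adjN : ∀ w, (SimComplex.stellar K F).PAdj none (some w) ↔ w ∈ F := by
    intro w
    constructor
    · rintro ⟨-, s, ⟨-, hs⟩, hn, hw⟩
      rcases hs with ⟨h, -⟩ | ⟨-, h, -⟩
      · exact absurd hn h
      · exact h.1 (by simpa using hw)
    · intro hw
      refine ⟨by simp, {none, some w}, ⟨⟨none, by simp⟩, Or.inr ⟨by simp, ?_⟩⟩, by simp, by simp⟩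
      have : Finset.eraseNone {none, some w} = {w} := by ext x; simp
      rw [this]
      refine ⟨?_, Or.inl (hK.sing w)⟩
      rw [Finset.ssubset_iff_subset_ne]
      refine ⟨by simpa using hw, ?_⟩
      rintro rfl
      simp at hF2
  have adjS : ∀ u w, (SimComplex.stellar K F).PAdj (some u) (some w) ↔
      K.PAdj u w ∧ ¬ (u ∈ F ∧ w ∈ F) := by
    intro u w
    constructor
    · rintro ⟨huw, s, ⟨-, hs⟩, hu, hw⟩
      have huw : u ≠ w := fun h => huw (by rw [h])
      have hu : u ∈ s.eraseNone := by simpa using hu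
      have hw : w ∈ s.eraseNone := by simpa using hw
      rcases hs with ⟨h, h1, h2⟩ | ⟨-, h, -⟩
      · refine ⟨⟨huw, _, h1, hu, hw⟩, ?_⟩
        rintro ⟨h3, h4⟩
        apply h2
        rw [sub2 huw h3 h4 hF2.le]
        intro x hx
        simp at hx
        rcases hx with rfl | rfl
        · exact hu
        · exact hw
      · have h3 := Finset.card_lt_card h
        have h4 : 1 < s.eraseNone.card := Finset.one_lt_card.2 ⟨u, hu, w, hw, huw⟩
        omega
    · rintro ⟨⟨huw, s, hs, hu, hw⟩, hn⟩
      refine ⟨by simpa using huw, s.map Function.Embedding.some, ⟨⟨some u, by simpa using hu⟩, Or.inl ⟨by simp, ?_, ?_⟩⟩,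
        by simpa using hu, by simpa using hw⟩
      · simpa using hs
      · intro h
        have h : F ⊆ s := by simpa using h
        have := Finset.eq_of_subset_of_card_le h (by rw [hF2]; exact hK.le2 s hs)
        subst this
        exact hn ⟨hu, hw⟩
  have adjNN : ¬ (SimComplex.stellar K F).PAdj none none := fun h => h.1 rfl
  have adjF : ∀ u w, u ∈ F → w ∈ F → u ≠ w → K.PAdj u w := fun u w hu hw h => ⟨h, F, hF.1, hu, hw⟩
  have adjN' : ∀ w, (SimComplex.stellar K F).PAdj (some w) none ↔ w ∈ F := fun w =>
    ⟨fun h => (adjN w).1 h.symm, fun h => ((adjN w).2 h).symm⟩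
  have := hK.fin
  refine ⟨inferInstance, ?_, ?_, ?_, ?_, ?_⟩
  · rw [Finite.card_option, hK.card]
  · intro v
    cases v with
    | none =>
      refine ⟨⟨none, by simp⟩, Or.inr ⟨by simp, ?_⟩⟩
      have : Finset.eraseNone ({none} : Finset (Option V)) = ∅ := by ext x; simp
      rw [this]
      refine ⟨?_, Or.inr rfl⟩
      rw [Finset.empty_ssubset, ← Finset.card_pos]; omega
    | some v =>
      refine ⟨⟨some v, by simp⟩, Or.inl ⟨by simp, ?_⟩⟩
      have : Finset.eraseNone ({some v} : Finset (Option V)) = {v} := by ext x; simp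
      rw [this]
      refine ⟨hK.sing v, fun h => ?_⟩
      have := Finset.card_le_card h
      simp at this
      omega
  · rintro s ⟨-, ⟨h1, h2, -⟩ | ⟨h1, h2, -⟩⟩
    · rw [← cardE s h1]; exact hK.le2 _ h2
    · rw [← cardE' s h1]
      have := Finset.card_lt_card h2
      omega
  · intro v
    cases v with
    | none =>
      obtain ⟨a, b, hab, hFab⟩ := Finset.card_eq_two.1 hF2
      refine ⟨some a, some b, by simpa using hab, fun w => ?_⟩
      cases w with
      | none => simp [adjNN]
      | some w => rw [adjN, hFab]; simp
    | some v =>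
      by_cases hv : v ∈ F
      · have : ∃ b, v ≠ b ∧ F = {v, b} := by
          obtain ⟨a, b, hab, hFab⟩ := Finset.card_eq_two.1 hF2
          rw [hFab] at hv
          simp at hv
          rcases hv with rfl | rfl
          · exact ⟨b, hab, hFab⟩
          · exact ⟨a, hab.symm, by rw [hFab, Finset.pair_comm]⟩
        obtain ⟨b, hvb, hFb⟩ := this
        have : ∃ c, c ≠ b ∧ ∀ w, K.PAdj v w ↔ w = b ∨ w = c := by
          obtain ⟨p, q, hpq, h⟩ := hK.reg v
          have hb := (h b).1 (adjF v b hv (by simp [hFb]) hvb)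
          rcases hb with rfl | rfl
          · exact ⟨q, hpq.symm, h⟩
          · exact ⟨p, hpq, fun w => by rw [h, or_comm]⟩
        obtain ⟨c, hcb, hc⟩ := this
        have hvc : v ≠ c := ((hc c).2 (Or.inr rfl)).1
        refine ⟨none, some c, by simp, fun w => ?_⟩
        cases w with
        | none => simp [adjN', hv]
        | some w =>
          rw [adjS, hc, hFb]
          simp
          constructor
          · rintro ⟨rfl | rfl, h1, h2⟩
            · exact absurd rfl h2
            · rfl
          · rintro rfl
            exact ⟨Or.inr rfl, hvc.symm, hcb⟩
      · obtain ⟨p, q, hpq, h⟩ := hK.reg v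
        refine ⟨some p, some q, by simpa using hpq, fun w => ?_⟩
        cases w with
        | none => simp [adjN', hv]
        | some w => simp [adjS, hv, h]
  · intro J hJ hJ'
    obtain ⟨a, b, hab, hFab⟩ := Finset.card_eq_two.1 hF2
    have haF : a ∈ F := by simp [hFab]
    by_cases h1 : (some ⁻¹' J).Nonempty
    · by_cases h2 : some ⁻¹' J = Set.univ
      · have hn : none ∉ J := by
          intro hn
          apply hJ'
          ext x
          cases x with
          | none => simpa using hn
          | some x =>
            have : x ∈ some ⁻¹' J := by rw [h2]; trivial
            simpa using this
        have : a ∈ some ⁻¹' J := by rw [h2]; trivial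
        exact ⟨some a, this, none, hn, (adjN' a).2 haF⟩
      · obtain ⟨v, hv, w, hw, h⟩ := hK.conn _ h1 h2
        by_cases h3 : v ∈ F ∧ w ∈ F
        · by_cases hn : none ∈ J
          · exact ⟨none, hn, some w, hw, (adjN w).2 h3.2⟩
          · exact ⟨some v, hv, none, hn, (adjN' v).2 h3.1⟩
        · exact ⟨some v, hv, some w, hw, (adjS _ _).2 ⟨h, h3⟩⟩
    · have hn : none ∈ J := by
        obtain ⟨x, hx⟩ := hJ
        cases x with
        | none => exact hx
        | some x => exact absurd ⟨x, hx⟩ h1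
      exact ⟨none, hn, some a, fun h => h1 ⟨a, h⟩, (adjN a).2 haF⟩

theorem isPoly_of_trunc (k : ℕ) : ∀ {V : Type} (K : SimComplex V),
    IsGenTruncCx 1 ![2] k V K → K.IsPoly (k + 3) := by
  induction k with
  | zero =>
    intro V K h
    exact isPoly_base.iso h
  | succ k ih =>
    rintro V K ⟨W, L, F, hL, hF, h⟩
    have := ((ih L hL).stellar hF).iso h
    exact this

end SimComplex

namespace SimComplex

section lin

variable {V : Type*} [Fintype V] [LinearOrder V] (𝕜 : Type*) [Field 𝕜] (L : SimComplex V)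

instance faceFinite (n : ℕ) : Finite (L.Face n) := by
  unfold Face; infer_instance

theorem finrank_chains (n : ℕ) : finrank 𝕜 (L.chains 𝕜 n) = Nat.card (L.Face n) := by
  have := Fintype.ofFinite (L.Face n)
  rw [Module.finrank_finsupp_self, Nat.card_eq_fintype_card]

theorem single_face_apply (n : ℕ) (u t : L.Face n) :
    Finsupp.single u (1 : 𝕜) t = if u.1 = t.1 then 1 else 0 := by
  classical
  rw [Finsupp.single_apply]
  exact if_congr Subtype.ext_iff rfl rfl

theorem aug_single (u : L.Face 0) (c : 𝕜) : L.augmentation 𝕜 (Finsupp.single u c) = c := by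
  unfold augmentation
  rw [Finsupp.lsum_apply, Finsupp.sum_single_index (by simp)]
  rfl

theorem aug_smul_single (u : L.Face 0) (c : 𝕜) :
    L.augmentation 𝕜 (c • Finsupp.single u 1) = c := by
  rw [map_smul, aug_single, smul_eq_mul, mul_one]

theorem fb_apply (s : L.Face 1) (t : L.Face 0) :
    L.faceBoundary 𝕜 0 s t = ∑ a ∈ s.1.attach,
      (-1 : 𝕜) ^ (s.1.filter (fun b => b < a.1)).card * (if s.1.erase a.1 = t.1 then 1 else 0) := by
  unfold faceBoundary
  rw [Finsupp.finsetSum_apply]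
  refine Finset.sum_congr rfl fun a _ => ?_
  rw [Finsupp.smul_apply, smul_eq_mul]
  congr 1
  exact L.single_face_apply 𝕜 0 _ t

theorem fb_zero (s : L.Face 1) (t : L.Face 0) (v : V) (ht : t.1 = {v}) (hv : v ∉ s.1) :
    L.faceBoundary 𝕜 0 s t = 0 := by
  rw [fb_apply]
  refine Finset.sum_eq_zero fun a _ => ?_
  rw [if_neg, mul_zero]
  intro h
  apply hv
  have : v ∈ s.1.erase a.1 := by rw [h, ht]; simp
  exact Finset.mem_of_mem_erase this

theorem fb_ne (s : L.Face 1) (t : L.Face 0) (v : V) (ht : t.1 = {v}) (hv : v ∈ s.1) :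
    L.faceBoundary 𝕜 0 s t ≠ 0 := by
  obtain ⟨b, hb⟩ : ∃ b, s.1.erase v = {b} := by
    apply Finset.card_eq_one.1
    rw [Finset.card_erase_of_mem hv, s.2.2]
  have hb' : b ∈ s.1.erase v := by rw [hb]; simp
  have hbv := Finset.ne_of_mem_erase hb'
  have hbs := Finset.mem_of_mem_erase hb'
  have hs : s.1 = {v, b} := by rw [← Finset.insert_erase hv, hb]
  rw [fb_apply, Finset.sum_eq_single ⟨b, hbs⟩]
  · rw [if_pos, mul_one]
    · exact pow_ne_zero _ (by simp)
    · rw [ht]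
      ext x
      simp only [hs, Finset.mem_erase, Finset.mem_insert, Finset.mem_singleton]
      constructor
      · tauto
      · rintro rfl
        exact ⟨hbv.symm, Or.inl rfl⟩
  · rintro ⟨a, ha⟩ - hne
    rw [if_neg, mul_zero]
    intro h
    have hab : a ≠ b := fun h => hne (by subst h; rfl)
    have : b ∈ s.1.erase a := Finset.mem_erase.2 ⟨hab.symm, hbs⟩
    rw [h, ht] at this
    simp at this
    exact hbv this
  · simp

theorem boundary_apply (z : L.chains 𝕜 1) (t : L.Face 0) :
    L.boundary 𝕜 0 z t = z.sum fun s c => c * L.faceBoundary 𝕜 0 s t := by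
  unfold boundary
  rw [Finsupp.lsum_apply, Finsupp.sum, Finsupp.finsetSum_apply]
  rfl

theorem aug_boundary (z : L.chains 𝕜 1) : L.augmentation 𝕜 (L.boundary 𝕜 0 z) = 0 := by
  have : (L.augmentation 𝕜).comp (L.boundary 𝕜 0) = 0 := by
    apply Finsupp.lhom_ext'
    intro s
    apply LinearMap.ext_ring
    simp only [LinearMap.comp_apply, boundary, Finsupp.lsingle_apply, LinearMap.zero_apply]
    rw [Finsupp.lsum_apply, Finsupp.sum_single_index (by simp)]
    simp only [LinearMap.toSpanSingleton_apply, one_smul]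
    unfold faceBoundary
    rw [map_sum]
    refine (Finset.sum_congr rfl fun a _ => L.aug_smul_single 𝕜 _ _).trans ?_
    refine (Finset.sum_attach s.1 (fun a => (-1 : 𝕜) ^ (s.1.filter (fun b => b < a)).card)).trans ?_
    obtain ⟨a, b, hab, hs⟩ : ∃ a b, a < b ∧ s.1 = {a, b} := by
      obtain ⟨a, b, hab, hs⟩ := Finset.card_eq_two.1 s.2.2
      rcases lt_or_gt_of_ne hab with h | h
      · exact ⟨a, b, h, hs⟩
      · exact ⟨b, a, h, by rw [hs, Finset.pair_comm]⟩
    rw [hs, Finset.sum_pair hab.ne]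
    simp [Finset.filter_insert, Finset.filter_singleton, hab, hab.not_gt]
  exact LinearMap.congr_fun this z

theorem range_le : LinearMap.range (L.boundary 𝕜 0) ≤ L.cycles 𝕜 0 := by
  rintro _ ⟨z, rfl⟩
  exact L.aug_boundary 𝕜 z

theorem finrank_cycles0 (v : V) (hv : {v} ∈ L.faces) :
    finrank 𝕜 (L.cycles 𝕜 0) + 1 = Nat.card (L.Face 0) := by
  have h := LinearMap.finrank_range_add_finrank_ker (L.augmentation 𝕜)
  have h1 : LinearMap.range (L.augmentation 𝕜) = ⊤ := by
    rw [LinearMap.range_eq_top]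
    intro c
    exact ⟨Finsupp.single ⟨{v}, hv, by simp⟩ c, L.aug_single 𝕜 _ c⟩
  rw [h1, finrank_top, Module.finrank_self, finrank_chains] at h
  rw [← h, add_comm]
  rfl

theorem h0_eq (v : V) (hv : {v} ∈ L.faces) :
    L.hdimNat 𝕜 0 + Nat.card (L.Face 1) + 1 =
      Nat.card (L.Face 0) + finrank 𝕜 (LinearMap.ker (L.boundary 𝕜 0)) := by
  unfold hdimNat
  rw [inf_eq_left.2 (L.range_le 𝕜)]
  have h1 := L.finrank_cycles0 𝕜 v hv
  have h2 := LinearMap.finrank_range_add_finrank_ker (L.boundary 𝕜 0)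
  have h3 := Submodule.finrank_mono (L.range_le 𝕜)
  rw [finrank_chains] at h2
  simp only [zero_add] at h2
  omega

theorem hdimNat_eq_zero (n : ℕ) (h : IsEmpty (L.Face n)) : L.hdimNat 𝕜 n = 0 := by
  unfold hdimNat
  have : finrank 𝕜 (L.cycles 𝕜 n) = 0 := Module.finrank_zero_of_subsingleton
  omega

theorem h1_eq (h : IsEmpty (L.Face 2)) :
    L.hdimNat 𝕜 1 = finrank 𝕜 (LinearMap.ker (L.boundary 𝕜 0)) := by
  unfold hdimNat
  have : LinearMap.range (L.boundary 𝕜 1) = ⊥ := by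
    rw [LinearMap.range_eq_bot]
    apply LinearMap.ext
    intro z
    have : z = 0 := by
      ext s
      exact h.elim s
    rw [this]
    simp
  rw [this, bot_inf_eq, finrank_bot]
  rfl

/-- if `v` is incident to at most one edge in the support of the cycle `z`, `z` vanishes there -/
theorem cycle_edge (z : L.chains 𝕜 1) (hz : L.boundary 𝕜 0 z = 0) (v : V) (s : L.Face 1)
    (hv : v ∈ s.1) (h : ∀ t : L.Face 1, z t ≠ 0 → v ∈ t.1 → t = s) : z s = 0 := by
  have hvf : {v} ∈ L.faces := L.down_closed s.2.1 (by simpa using hv) (by simp)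
  let t : L.Face 0 := ⟨{v}, hvf, by simp⟩
  have h1 : L.boundary 𝕜 0 z t = 0 := by rw [hz]; rfl
  rw [boundary_apply, Finsupp.sum, Finset.sum_eq_single s] at h1
  · exact (mul_eq_zero.1 h1).resolve_right (L.fb_ne 𝕜 s t v rfl hv)
  · intro u hu hus
    rw [L.fb_zero 𝕜 u t v rfl, mul_zero]
    intro hvu
    exact hus (h u (by simpa using hu) hvu)
  · intro hs
    rw [Finsupp.notMem_support_iff] at hs
    rw [hs, zero_mul]

theorem cycle_zero (z : L.chains 𝕜 1) (hz : L.boundary 𝕜 0 z = 0) (S : Finset V)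
    (hS : ∀ s : L.Face 1, z s ≠ 0 → s.1 ⊆ S)
    (h : ∀ T ⊆ S, T.Nonempty → ∃ v ∈ T, ∀ s t : L.Face 1, s.1 ⊆ T → t.1 ⊆ T → v ∈ s.1 → v ∈ t.1 → s = t) :
    z = 0 := by
  induction S using Finset.strongInduction with
  | H S ih =>
    by_cases hne : S.Nonempty
    · obtain ⟨v, hv, hv'⟩ := h S subset_rfl hne
      refine ih (S.erase v) (Finset.erase_ssubset hv) ?_ ?_
      · intro s hs
        refine Finset.subset_erase.2 ⟨hS s hs, fun hvs => hs ?_⟩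
        exact L.cycle_edge 𝕜 z hz v s hvs fun t ht hvt => hv' t s (hS t ht) (hS s hs) hvt hvs
      · intro T hT
        exact h T (hT.trans (Finset.erase_subset _ _))
    · ext s
      by_contra hs
      have := hS s hs
      rw [Finset.not_nonempty_iff_eq_empty.1 hne, Finset.subset_empty] at this
      have h2 := s.2.2
      rw [this] at h2
      simp at h2

end lin

section poly
variable {V : Type*} [Fintype V] [LinearOrder V] (𝕜 : Type*) [Field 𝕜] {K : SimComplex V} {m : ℕ}

theorem IsPoly.empty (hK : K.IsPoly m) (J : Finset V) (n : ℕ) (hn : 2 ≤ n) :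
    IsEmpty ((K.restrict J).Face n) := by
  refine ⟨fun s => ?_⟩
  have := hK.le2 _ s.2.1.1
  rw [s.2.2] at this
  omega

theorem IsPoly.edge_eq (hK : K.IsPoly m) {J : Finset V} {s : (K.restrict J).Face 1} {v : V} (hv : v ∈ s.1) :
    ∃ w, s.1 = {v, w} ∧ K.PAdj v w := by
  obtain ⟨b, hb⟩ : ∃ b, s.1.erase v = {b} := by
    apply Finset.card_eq_one.1
    rw [Finset.card_erase_of_mem hv, s.2.2]
  have hb' : b ∈ s.1.erase v := by rw [hb]; simp
  exact ⟨b, by rw [← Finset.insert_erase hv, hb], (Finset.ne_of_mem_erase hb').symm, s.1, s.2.1.1, hv,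
    Finset.mem_of_mem_erase hb'⟩

theorem IsPoly.deg_one (hK : K.IsPoly m) (J T : Finset V) (hT : T.Nonempty) (hT' : T ≠ Finset.univ) :
    ∃ v ∈ T, ∀ s t : (K.restrict J).Face 1, s.1 ⊆ T → t.1 ⊆ T → v ∈ s.1 → v ∈ t.1 → s = t := by
  obtain ⟨v, hv, w, hw, hvw⟩ := hK.conn T hT (by simpa using hT')
  refine ⟨v, hv, fun s t hs ht hvs hvt => ?_⟩
  obtain ⟨a, ha, hva⟩ := hK.edge_eq hvs
  obtain ⟨b, hb, hvb⟩ := hK.edge_eq hvt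
  have haw : a ≠ w := by
    rintro rfl
    exact hw (hs (by rw [ha]; simp))
  have hbw : b ≠ w := by
    rintro rfl
    exact hw (ht (by rw [hb]; simp))
  obtain ⟨p, q, hpq, h⟩ := hK.reg v
  rw [h] at hva hvb hvw
  have : a = b := by grind
  apply Subtype.ext
  rw [ha, hb, this]

theorem IsPoly.ker_proper (hK : K.IsPoly m) (J : Finset V) (hJ : J ≠ Finset.univ) :
    finrank 𝕜 (LinearMap.ker ((K.restrict J).boundary 𝕜 0)) = 0 := by
  have : LinearMap.ker ((K.restrict J).boundary 𝕜 0) = ⊥ := by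
    rw [LinearMap.ker_eq_bot']
    intro z hz
    refine cycle_zero 𝕜 _ z hz J (fun s _ => s.2.1.2) ?_
    intro T hT hne
    refine hK.deg_one J T hne ?_
    rintro rfl
    exact hJ (Finset.univ_subset_iff.1 hT)
  rw [this, finrank_bot]

theorem IsPoly.face0 (hK : K.IsPoly m) (J : Finset V) :
    Nat.card ((K.restrict J).Face 0) = J.card := by
  have : Nat.card J = J.card := by simp
  rw [← this]
  symm
  refine Nat.card_eq_of_bijective
    (fun v : J => (⟨{v.1}, ⟨hK.sing _, by simp⟩, by simp⟩ : (K.restrict J).Face 0)) ⟨?_, ?_⟩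
  · intro v w h
    have := congrArg Subtype.val h
    simp at this
    exact this
  · rintro ⟨s, ⟨h1, h2⟩, h3⟩
    obtain ⟨v, rfl⟩ := Finset.card_eq_one.1 h3
    exact ⟨⟨v, by simpa using h2⟩, rfl⟩

open Classical in
/-- the edges of `K` -/
noncomputable def edgs (K : SimComplex V) : Finset (Finset V) :=
  Finset.univ.filter fun s => s ∈ K.faces ∧ s.card = 2

theorem face1 (K : SimComplex V) (J : Finset V) :
    Nat.card ((K.restrict J).Face 1) = (K.edgs.filter (fun e => e ⊆ J)).card := by
  refine Nat.subtype_card _ fun s => ?_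
  simp only [edgs, restrict, Finset.mem_filter, Finset.mem_univ, true_and, Set.mem_ofPred_eq]
  tauto

theorem IsPoly.card_edgs (hK : K.IsPoly m) : K.edgs.card = m := by
  have h := Finset.sum_card_bipartiteAbove_eq_sum_card_bipartiteBelow
    (s := (Finset.univ : Finset V)) (t := K.edgs) (fun v e => v ∈ e)
  have h1 : ∀ v ∈ (Finset.univ : Finset V), (Finset.bipartiteAbove (fun v e => v ∈ e) K.edgs v).card = 2 := by
    intro v _
    obtain ⟨p, q, hpq, h⟩ := hK.reg v
    have key : ∀ w, K.PAdj v w → {v, w} ∈ K.edgs := by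
      rintro w ⟨hvw, s, hs, hv, hw⟩
      simp only [edgs, Finset.mem_filter, Finset.mem_univ, true_and]
      refine ⟨K.down_closed hs ?_ (by simp), Finset.card_pair hvw⟩
      intro x hx
      simp at hx
      rcases hx with rfl | rfl <;> assumption
    have hp := (h p).2 (Or.inl rfl)
    have hq := (h q).2 (Or.inr rfl)
    have : Finset.bipartiteAbove (fun v e => v ∈ e) K.edgs v = {{v, p}, {v, q}} := by
      ext e
      simp only [Finset.bipartiteAbove, Finset.mem_filter, Finset.mem_insert, Finset.mem_singleton]
      constructor
      · rintro ⟨he, hv⟩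
        simp only [edgs, Finset.mem_filter, Finset.mem_univ, true_and] at he
        obtain ⟨b, hb⟩ : ∃ b, e.erase v = {b} := by
          apply Finset.card_eq_one.1
          rw [Finset.card_erase_of_mem hv, he.2]
        have hb' : b ∈ e.erase v := by rw [hb]; simp
        have hs : e = {v, b} := by rw [← Finset.insert_erase hv, hb]
        have : K.PAdj v b := ⟨(Finset.ne_of_mem_erase hb').symm, e, he.1, hv,
          Finset.mem_of_mem_erase hb'⟩
        rcases (h b).1 this with rfl | rfl
        · exact Or.inl hs
        · exact Or.inr hs
      · rintro (rfl | rfl)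
        · exact ⟨key _ hp, by simp⟩
        · exact ⟨key _ hq, by simp⟩
    rw [this, Finset.card_pair]
    intro h
    have : p ∈ ({v, q} : Finset V) := by rw [← h]; simp
    simp at this
    rcases this with h' | h'
    · exact hp.1 h'.symm
    · exact hpq h'
  have h2 : ∀ e ∈ K.edgs, (Finset.bipartiteBelow (fun v e => v ∈ e) (Finset.univ : Finset V) e).card = 2 := by
    intro e he
    simp only [edgs, Finset.mem_filter, Finset.mem_univ, true_and] at he
    rw [← he.2]
    congr 1
    ext x
    simp [Finset.bipartiteBelow]
  rw [Finset.sum_congr rfl h1, Finset.sum_congr rfl h2, Finset.sum_const, Finset.sum_const,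
    Finset.card_univ, ← Nat.card_eq_fintype_card, hK.card] at h
  simp at h
  exact h.symm

theorem card_sup (e : Finset V) (he : e.card = 2) (j : ℕ) :
    ((Finset.powersetCard (j + 2) (Finset.univ : Finset V)).filter (fun J => e ⊆ J)).card =
      (Fintype.card V - 2).choose j := by
  have : (Fintype.card V - 2).choose j = (Finset.powersetCard j (Finset.univ \ e)).card := by
    rw [Finset.card_powersetCard, Finset.card_sdiff_of_subset (Finset.subset_univ _), he, Finset.card_univ]
  rw [this]
  refine Finset.card_nbij' (fun J => J \ e) (fun J => J ∪ e) ?_ ?_ ?_ ?_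
  · intro J hJ
    simp at hJ
    simp only [Finset.mem_coe, Finset.mem_powersetCard]
    refine ⟨Finset.sdiff_subset_sdiff (Finset.subset_univ _) subset_rfl, ?_⟩
    rw [Finset.card_sdiff_of_subset hJ.2]
    omega
  · intro J hJ
    rw [Finset.mem_coe, Finset.mem_powersetCard] at hJ
    simp only [Finset.mem_coe, Finset.mem_filter, Finset.mem_powersetCard]
    refine ⟨⟨Finset.subset_univ _, ?_⟩, Finset.subset_union_right⟩
    rw [Finset.card_union_of_disjoint, he, hJ.2]
    exact Finset.disjoint_left.2 fun x hx => (Finset.mem_sdiff.1 (hJ.1 hx)).2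
  · intro J hJ
    simp at hJ
    exact Finset.sdiff_union_of_subset hJ.2
  · intro J hJ
    rw [Finset.mem_coe, Finset.mem_powersetCard] at hJ
    apply Finset.union_sdiff_cancel_right
    exact Finset.disjoint_left.2 fun x hx => (Finset.mem_sdiff.1 (hJ.1 hx)).2

theorem IsPoly.sum_edges (hK : K.IsPoly m) (j : ℕ) :
    ∑ J ∈ Finset.powersetCard (j + 2) (Finset.univ : Finset V), Nat.card ((K.restrict J).Face 1) =
      m * (m - 2).choose j := by
  simp only [face1]
  have h := Finset.sum_card_bipartiteAbove_eq_sum_card_bipartiteBelow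
    (s := Finset.powersetCard (j + 2) (Finset.univ : Finset V)) (t := K.edgs) (fun J e => e ⊆ J)
  simp only [Finset.bipartiteAbove, Finset.bipartiteBelow] at h
  rw [h]
  have h2 : ∀ e ∈ K.edgs, ((Finset.powersetCard (j + 2) (Finset.univ : Finset V)).filter (fun J => e ⊆ J)).card =
      (m - 2).choose j := by
    intro e he
    simp only [edgs, Finset.mem_filter, Finset.mem_univ, true_and] at he
    rw [card_sup e he.2, ← Nat.card_eq_fintype_card, hK.card]
  rw [Finset.sum_congr rfl h2, Finset.sum_const, hK.card_edgs, smul_eq_mul]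

theorem IsPoly.ker_univ (hK : K.IsPoly m) (v : V) :
    finrank 𝕜 (LinearMap.ker ((K.restrict Finset.univ).boundary 𝕜 0)) = 1 := by
  have hm : Nat.card ((K.restrict Finset.univ).Face 0) = m := by
    rw [hK.face0, Finset.card_univ, ← Nat.card_eq_fintype_card, hK.card]
  have hm1 : Nat.card ((K.restrict Finset.univ).Face 1) = m := by
    rw [face1, ← hK.card_edgs]
    congr 1
    simp
  have h1 := h0_eq 𝕜 (K.restrict Finset.univ) v ⟨hK.sing v, by simp⟩
  have h2 : finrank 𝕜 (LinearMap.ker ((K.restrict Finset.univ).boundary 𝕜 0)) ≤ 1 := by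
    obtain ⟨p, q, hpq, h⟩ := hK.reg v
    obtain ⟨hvp, s, hs, hv, hp⟩ := (h p).2 (Or.inl rfl)
    have hsf : s.card = 1 + 1 := by
      have := hK.le2 s hs
      have : 1 < s.card := Finset.one_lt_card.2 ⟨v, hv, p, hp, hvp⟩
      omega
    let e : (K.restrict Finset.univ).Face 1 := ⟨s, ⟨hs, by simp⟩, hsf⟩
    have hs' : e.1 = {v, p} := by
      symm
      apply Finset.eq_of_subset_of_card_le
      · intro x hx
        simp at hx
        rcases hx with rfl | rfl <;> assumption
      · rw [Finset.card_pair hvp]; exact hK.le2 s hs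
    have := LinearMap.finrank_le_finrank_of_injective
      (f := (Finsupp.lapply (R := 𝕜) e).comp (LinearMap.ker ((K.restrict Finset.univ).boundary 𝕜 0)).subtype) ?_
    · rwa [Module.finrank_self] at this
    · refine (injective_iff_map_eq_zero _).2 ?_
      rintro ⟨z, hz⟩ hze
      rw [LinearMap.mem_ker] at hz
      have hze : z e = 0 := hze
      have hedge : ∀ t : (K.restrict Finset.univ).Face 1, z t ≠ 0 → v ∈ t.1 → t.1 = {v, q} := by
        intro t ht hvt
        obtain ⟨b, hb, hvb⟩ := hK.edge_eq hvt
        rcases (h b).1 hvb with rfl | rfl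
        · exfalso
          apply ht
          have : t = e := Subtype.ext (by rw [hb, hs'])
          rw [this, hze]
        · exact hb
      have : z = 0 := by
        refine cycle_zero 𝕜 _ z hz (Finset.univ.erase v) ?_ ?_
        · intro t ht
          refine Finset.subset_erase.2 ⟨Finset.subset_univ _, fun hvt => ht ?_⟩
          refine cycle_edge 𝕜 _ z hz v t hvt fun u hu hvu => ?_
          apply Subtype.ext
          rw [hedge u hu hvu, hedge t ht hvt]
        · intro T hT hne
          refine hK.deg_one _ T hne ?_
          rintro rfl
          have := hT (Finset.mem_univ v)
          simp at this
      exact Subtype.ext this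
  omega

theorem hdim_nat (L : SimComplex V) (n : ℕ) : L.hdim 𝕜 n = L.hdimNat 𝕜 n := by
  unfold hdim
  rw [if_neg (by omega), if_pos (by omega)]
  simp

theorem IsPoly.h0_proper (hK : K.IsPoly m) (J : Finset V) (hJ : J ≠ Finset.univ) (hne : J.Nonempty) :
    (K.restrict J).hdimNat 𝕜 0 + Nat.card ((K.restrict J).Face 1) + 1 = J.card := by
  obtain ⟨v, hv⟩ := hne
  rw [h0_eq 𝕜 (K.restrict J) v ⟨hK.sing v, by simpa using hv⟩, hK.face0, hK.ker_proper 𝕜 J hJ, add_zero]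

theorem IsPoly.h0_univ (hK : K.IsPoly m) (v : V) :
    (K.restrict Finset.univ).hdimNat 𝕜 0 = 0 := by
  have h1 := h0_eq 𝕜 (K.restrict Finset.univ) v ⟨hK.sing v, by simp⟩
  rw [hK.face0, hK.ker_univ 𝕜 v, face1, Finset.filter_true_of_mem (by simp), hK.card_edgs, Finset.card_univ,
    ← Nat.card_eq_fintype_card, hK.card] at h1
  omega

theorem IsPoly.main (k : ℕ) (hK : K.IsPoly (k + 3)) :
    (∀ i : ℕ, K.bbetti 𝕜 i (i + 1) =
      i * (k + 1).choose (i + 1) + (k + 1 - i) * (k + 1).choose (k + 2 - i)) ∧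
    (K.bbetti 𝕜 0 0 = 1 ∧ K.bbetti 𝕜 (k + 1) (k + 3) = 1) ∧
    (∀ i j : ℕ, K.bbetti 𝕜 i j ≠ 0 →
      (i = 0 ∧ j = 0) ∨ (i = k + 1 ∧ j = k + 3) ∨ j = i + 1) := by
  have hcard : Fintype.card V = k + 3 := by rw [← Nat.card_eq_fintype_card, hK.card]
  obtain ⟨v⟩ : Nonempty V := by
    rw [← Fintype.card_pos_iff]; omega
  have hpu : Finset.powersetCard (k + 3) (Finset.univ : Finset V) = {Finset.univ} := by
    rw [← hcard, ← Finset.card_univ, Finset.powersetCard_self]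
  refine ⟨fun i => ?_, ⟨?_, ?_⟩, ?_⟩
  · unfold bbetti
    have e0 : ((i + 1 : ℕ) : ℤ) - i - 1 = (0 : ℕ) := by push_cast; ring
    rw [e0]
    simp only [hdim_nat]
    rcases lt_trichotomy (i + 1) (k + 3) with hi | hi | hi
    · have hprop : ∀ J ∈ Finset.powersetCard (i + 1) (Finset.univ : Finset V),
          (K.restrict J).hdimNat 𝕜 0 + Nat.card ((K.restrict J).Face 1) + 1 = i + 1 := by
        intro J hJ
        have hJ := (Finset.mem_powersetCard.1 hJ).2
        rw [hK.h0_proper 𝕜 J, hJ]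
        · rintro rfl
          rw [Finset.card_univ] at hJ
          omega
        · rw [← Finset.card_pos]; omega
      cases i with
      | zero =>
        rw [Finset.sum_eq_zero]
        · simp
        · intro J hJ
          have := hprop J hJ
          omega
      | succ i =>
        have h := Finset.sum_congr rfl hprop
        rw [Finset.sum_add_distrib, Finset.sum_add_distrib, hK.sum_edges, Finset.sum_const, Finset.sum_const,
          Finset.card_powersetCard, Finset.card_univ, hcard] at h
        simp only [smul_eq_mul, mul_one] at h
        have hs : (k + 1).choose (k + 2 - (i + 1)) = (k + 1).choose i := by
          rw [← Nat.choose_symm_of_eq_add (n := k + 1) (a := k + 2 - (i + 1)) (b := i)]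
          omega
        rw [hs]
        have hk3 : (k + 3).choose (i + 2) = (k + 1).choose (i + 2) + 2 * (k + 1).choose (i + 1) + (k + 1).choose i := by
          rw [Nat.choose_succ_succ (k + 2) (i + 1), Nat.choose_succ_succ (k + 1) (i + 1), Nat.choose_succ_succ (k + 1) i]
          ring
        have hrec := Nat.choose_succ_right_eq (k + 1) i
        have hk2 : k + 3 - 2 = k + 1 := by omega
        have hi2 : i + 1 + 1 = i + 2 := rfl
        rw [hi2, hk3, hk2] at h
        rw [hi2]
        obtain ⟨d, hd⟩ : ∃ d, k = i + d := ⟨k - i, by omega⟩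
        have e1 : k + 1 - (i + 1) = d := by omega
        have e2 : k + 1 - i = d + 1 := by omega
        rw [e1]
        rw [e2] at hrec
        have hk' : k + 3 = i + d + 3 := by omega
        rw [hk'] at h
        nlinarith
    · rw [hi, hpu, Finset.sum_singleton, hK.h0_univ 𝕜 v]
      have : i = k + 2 := by omega
      subst this
      rw [Nat.choose_eq_zero_of_lt (by omega)]
      have : k + 1 - (k + 2) = 0 := by omega
      rw [this]
      simp
    · rw [Finset.powersetCard_eq_empty.2 (by rw [Finset.card_univ]; omega), Finset.sum_empty,
        Nat.choose_eq_zero_of_lt (by omega)]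
      have : k + 1 - i = 0 := by omega
      rw [this]
      simp
  · unfold bbetti
    rw [Finset.powersetCard_zero, Finset.sum_singleton]
    unfold hdim
    have : (K.restrict ∅).faces = ∅ := by
      ext s
      simp only [restrict, Set.mem_ofPred_eq, Set.mem_empty_iff_false, iff_false]
      rintro ⟨h1, h2⟩
      rw [Finset.subset_empty] at h2
      exact K.not_empty_mem (h2 ▸ h1)
    rw [if_pos (by simp), if_pos this]
  · unfold bbetti
    have e0 : ((k + 3 : ℕ) : ℤ) - (k + 1 : ℕ) - 1 = (1 : ℕ) := by push_cast; ring
    rw [e0, hpu, Finset.sum_singleton, hdim_nat, h1_eq _ _ (hK.empty _ 2 le_rfl), hK.ker_univ 𝕜 v]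
  · intro i j h
    unfold bbetti at h
    obtain ⟨J, hJ, hJ0⟩ := Finset.exists_ne_zero_of_sum_ne_zero h
    have hJ := (Finset.mem_powersetCard.1 hJ).2
    rcases lt_trichotomy j i with hji | hji | hji
    · exfalso
      apply hJ0
      unfold hdim
      rw [if_neg (by omega), if_neg (by omega)]
    · left
      have e : (j : ℤ) - i - 1 = -1 := by omega
      rw [e] at hJ0
      unfold hdim at hJ0
      rw [if_pos rfl] at hJ0
      have hf : (K.restrict J).faces = ∅ := by
        by_contra hf
        rw [if_neg hf] at hJ0
        exact hJ0 rfl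
      have : J = ∅ := by
        by_contra hne
        obtain ⟨x, hx⟩ := Finset.nonempty_iff_ne_empty.2 hne
        have : ({x} : Finset V) ∈ (K.restrict J).faces := ⟨hK.sing x, by simpa using hx⟩
        rw [hf] at this
        exact this
      rw [this] at hJ
      simp at hJ
      omega
    · obtain ⟨n, rfl⟩ : ∃ n, j = i + 1 + n := ⟨j - i - 1, by omega⟩
      have e : ((i + 1 + n : ℕ) : ℤ) - i - 1 = n := by push_cast; ring
      rw [e, hdim_nat] at hJ0
      right
      match n with
      | 0 => right; rfl
      | 1 =>
        left
        by_cases hJu : J = Finset.univ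
        · rw [hJu, Finset.card_univ] at hJ
          omega
        · rw [h1_eq _ _ (hK.empty _ 2 le_rfl), hK.ker_proper 𝕜 J hJu] at hJ0
          exact absurd rfl hJ0
      | n + 2 =>
        exact absurd (hdimNat_eq_zero _ _ _ (hK.empty _ _ (by omega))) hJ0

end poly

end SimComplex

/-- **Bigraded Betti numbers of polygons** (see Buchstaber–Panov, Example 8.21, and
Limonchenko, Proposition 2.7).  Let `P = vc^k(Δ²)` be the `(k+3)`-gon, whose dual
boundary complex `K = K_P` is the boundary `(k+3)`-cycle.  Over a field `𝕜` of
characteristic zero: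
(a) `β^{-i,2(i+1)}(P) = i·C(k+1, i+1) + (k+1-i)·C(k+1, k+2-i)`;
(b) `β^{0,0}(P) = β^{-(k+1),2(k+3)}(P) = 1`;
and all other bigraded Betti numbers vanish. -/
theorem polygon_bigraded_betti
    (k : ℕ)
    {V : Type} [Fintype V] [LinearOrder V] (K : SimComplex V)
    (hK : IsGenTruncCx 1 ![2] k V K)
    (𝕜 : Type) [Field 𝕜] [CharZero 𝕜] :
    (∀ i : ℕ, K.bbetti 𝕜 i (i + 1) =
      i * (k + 1).choose (i + 1) + (k + 1 - i) * (k + 1).choose (k + 2 - i)) ∧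
    (K.bbetti 𝕜 0 0 = 1 ∧ K.bbetti 𝕜 (k + 1) (k + 3) = 1) ∧
    (∀ i j : ℕ, K.bbetti 𝕜 i j ≠ 0 →
      (i = 0 ∧ j = 0) ∨ (i = k + 1 ∧ j = k + 3) ∨ j = i + 1) := by
  exact (SimComplex.isPoly_of_trunc k K hK).main 𝕜 k
end
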